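/- arXiv:math/0211192 — 4 statements merged into one kernel-verified Lean document; each statement's English description precedes it below -/
import Mathlib

section
/- Let q ≥ 2, let V₁, …, V_N be normed real or complex vector spaces, and let V be their ℓ_q-direct sum, i.e. the direct sum equipped with the norm ‖(v₁, …, v_N)‖ = ( Σ_j ‖v_j‖_{V_j}^q )^{1/q}. For each j let μ_j be a probability measure on V_j supported on a compact set of diameter at most 1, and let P = μ₁ ⊗ ⋯ ⊗ μ_N be the product measure on V. Suppose F : V → ℝ is 1-Lipschitz (with respect to the ℓ_q-sum norm) and quasiconvex, meaning F⁻¹((−∞, a]) is convex for every a ∈ ℝ. Then for every median M of F and all t > 0, P[ |F − M| ≥ t ] ≤ 4 e^{−t^q/4}. -/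
open MeasureTheory ProbabilityTheory

/-- `M` is a median of the real random variable `Y` under `μ`. -/
def IsMedian {Ω : Type*} [MeasurableSpace Ω] (μ : Measure Ω) (Y : Ω → ℝ) (M : ℝ) : Prop :=
  1 / 2 ≤ μ {ω | Y ω ≤ M} ∧ 1 / 2 ≤ μ {ω | M ≤ Y ω}

open Set


section PowerDistance

variable {ι : Type*} [Fintype ι] {V : ι → Type*} [∀ j, NormedAddCommGroup (V j)]

/-- The `q`-th power of the `ℓ_q`-distance from `x` to the set `C` (zero if `C` is empty). -/
noncomputable def infPowDist (q : ℝ) (C : Set (∀ j, V j)) (x : ∀ j, V j) : ℝ :=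
  ⨅ y : C, ∑ j, ‖x j - y.1 j‖ ^ q

theorem bddBelow_powDist (q : ℝ) (C : Set (∀ j, V j)) (x : ∀ j, V j) :
    BddBelow (range fun y : C => ∑ j, ‖x j - y.1 j‖ ^ q) :=
  ⟨0, by rintro _ ⟨y, rfl⟩; positivity⟩

theorem infPowDist_le {q : ℝ} {C : Set (∀ j, V j)} {x y : ∀ j, V j} (hy : y ∈ C) :
    infPowDist q C x ≤ ∑ j, ‖x j - y j‖ ^ q :=
  ciInf_le (bddBelow_powDist q C x) ⟨y, hy⟩

theorem le_infPowDist {q c : ℝ} {C : Set (∀ j, V j)} {x : ∀ j, V j} (hC : C.Nonempty)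
    (h : ∀ y ∈ C, c ≤ ∑ j, ‖x j - y j‖ ^ q) : c ≤ infPowDist q C x :=
  have := hC.to_subtype
  le_ciInf fun y => h y.1 y.2

theorem exists_powDist_lt {q ε : ℝ} {C : Set (∀ j, V j)} (hC : C.Nonempty) (x : ∀ j, V j)
    (hε : 0 < ε) : ∃ y ∈ C, ∑ j, ‖x j - y j‖ ^ q < infPowDist q C x + ε := by
  have := hC.to_subtype
  obtain ⟨y, hy⟩ := exists_lt_of_ciInf_lt (lt_add_of_pos_right (infPowDist q C x) hε)
  exact ⟨y.1, y.2, hy⟩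

theorem measurable_infPowDist_comp {X : Type*} [TopologicalSpace X] [MeasurableSpace X]
    [OpensMeasurableSpace X] {q : ℝ} (hq : 0 ≤ q) (C : Set (∀ j, V j)) {f : X → ∀ j, V j}
    (hf : Continuous f) : Measurable fun x => infPowDist q C (f x) := by
  refine (upperSemicontinuous_ciInf (fun x => bddBelow_powDist q C (f x))
    fun y => Continuous.upperSemicontinuous ?_).measurable
  refine continuous_finsetSum _ fun j _ => Continuous.rpow_const ?_ fun _ => Or.inr hq
  fun_prop

theorem norm_convexComb_rpow_le {E : Type*} [NormedAddCommGroup E] [NormedSpace ℝ E] {q : ℝ}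
    (hq : 1 ≤ q) {a b : ℝ} (ha : 0 ≤ a) (hb : 0 ≤ b) (hab : a + b = 1) (x y z : E) :
    ‖x - (a • y + b • z)‖ ^ q ≤ a * ‖x - y‖ ^ q + b * ‖x - z‖ ^ q := by
  have hx : x - (a • y + b • z) = a • (x - y) + b • (x - z) := by
    rw [smul_sub, smul_sub, sub_add_sub_comm, ← add_smul, hab, one_smul]
  have h1 : ‖x - (a • y + b • z)‖ ≤ a * ‖x - y‖ + b * ‖x - z‖ := by
    rw [hx]
    refine (norm_add_le _ _).trans ?_
    rw [norm_smul, norm_smul, Real.norm_of_nonneg ha, Real.norm_of_nonneg hb]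
  refine (Real.rpow_le_rpow (norm_nonneg _) h1 (by linarith)).trans ?_
  simpa using (convexOn_rpow hq).2 (norm_nonneg (x - y)) (norm_nonneg (x - z)) ha hb hab

end PowerDistance

theorem piMap_insertNth {n : ℕ} {K V : Fin (n + 1) → Type*} (i : Fin (n + 1))
    (φ : ∀ j, K j → V j) (w : K i) (x : ∀ j, K (i.succAbove j)) :
    Pi.map φ (i.insertNth w x) =
      i.insertNth (φ i w) (Pi.map (fun j => φ (i.succAbove j)) x) := by
  funext j
  induction j using Fin.succAboveCases i with
  | x => simp
  | p j => simp

theorem insertNth_convexComb {n : ℕ} {V : Fin (n + 1) → Type*} [∀ j, AddCommGroup (V j)]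
    [∀ j, Module ℝ (V j)] (i : Fin (n + 1)) (a b : ℝ) (u v : V i)
    (y z : ∀ j, V (i.succAbove j)) :
    (i.insertNth (a • u + b • v) (a • y + b • z) : ∀ j, V j) =
      a • i.insertNth u y + b • i.insertNth v z := by
  funext j
  induction j using Fin.succAboveCases i with
  | x => simp
  | p j => simp

/-- Moving in the first coordinate: the distance to a convex set is controlled by the distances to
a section and to a projection. -/
theorem infPowDist_insertNth_le {n : ℕ} {V : Fin (n + 1) → Type*}
    [∀ j, NormedAddCommGroup (V j)] [∀ j, NormedSpace ℝ (V j)] {q : ℝ} (hq : 2 ≤ q)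
    (i : Fin (n + 1)) {C : Set (∀ j, V j)} (hC : Convex ℝ C)
    {C₁ C₂ : Set (∀ j, V (i.succAbove j))} (hC₁ : C₁.Nonempty) (hC₂ : C₂.Nonempty) {w : V i}
    (h₁ : ∀ y ∈ C₁, (i.insertNth w y : ∀ j, V j) ∈ C)
    (h₂ : ∀ y ∈ C₂, ∃ u, ‖w - u‖ ≤ 1 ∧ (i.insertNth u y : ∀ j, V j) ∈ C)
    (x : ∀ j, V (i.succAbove j)) {a b : ℝ} (ha : 0 ≤ a) (hb : 0 ≤ b) (hab : a + b = 1) :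
    infPowDist q C (i.insertNth w x) ≤
      a * infPowDist q C₁ x + b * infPowDist q C₂ x + b ^ 2 := by
  refine le_of_forall_pos_le_add fun ε hε => ?_
  obtain ⟨y, hy, hyε⟩ := exists_powDist_lt (q := q) hC₁ x hε
  obtain ⟨z, hz, hzε⟩ := exists_powDist_lt (q := q) hC₂ x hε
  obtain ⟨u, hu, huz⟩ := h₂ z hz
  have hmem := hC (h₁ y hy) huz ha hb hab
  rw [← insertNth_convexComb] at hmem
  refine (infPowDist_le hmem).trans ?_
  rw [Fin.sum_univ_succAbove _ i]
  simp only [Fin.insertNth_apply_same, Fin.insertNth_apply_succAbove]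
  have hfirst : ‖w - (a • w + b • u)‖ ^ q ≤ b ^ 2 := by
    have hw : w - (a • w + b • u) = b • (w - u) := by
      have : a = 1 - b := by linarith
      rw [this, sub_smul, one_smul, smul_sub]; abel
    have hle : ‖w - (a • w + b • u)‖ ≤ b := by
      rw [hw, norm_smul, Real.norm_of_nonneg hb]
      exact mul_le_of_le_one_right hb hu
    have hq0 : 0 ≤ q := by linarith
    refine (Real.rpow_le_rpow (norm_nonneg _) hle hq0).trans ?_
    rw [← Real.rpow_two]
    exact Real.rpow_le_rpow_of_exponent_ge_of_imp hb (by linarith) hq (by intro _ h; linarith)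
  have hrest : ∑ j, ‖x j - (a • y + b • z) j‖ ^ q ≤
      a * ∑ j, ‖x j - y j‖ ^ q + b * ∑ j, ‖x j - z j‖ ^ q := by
    rw [Finset.mul_sum, Finset.mul_sum, ← Finset.sum_add_distrib]
    exact Finset.sum_le_sum fun j _ =>
      norm_convexComb_rpow_le (by linarith) ha hb hab (x j) (y j) (z j)
  have e1 := mul_le_mul_of_nonneg_left hyε.le ha
  have e2 := mul_le_mul_of_nonneg_left hzε.le hb
  have e3 : a * ε + b * ε = ε := by rw [← add_mul, hab, one_mul]
  linarith

theorem infPowDist_insertNth_le_add_one {n : ℕ} {V : Fin (n + 1) → Type*}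
    [∀ j, NormedAddCommGroup (V j)] {q : ℝ} (hq : 0 ≤ q) (i : Fin (n + 1))
    {C : Set (∀ j, V j)} {C₂ : Set (∀ j, V (i.succAbove j))} (hC₂ : C₂.Nonempty) {w : V i}
    (h₂ : ∀ y ∈ C₂, ∃ u, ‖w - u‖ ≤ 1 ∧ (i.insertNth u y : ∀ j, V j) ∈ C)
    (x : ∀ j, V (i.succAbove j)) :
    infPowDist q C (i.insertNth w x) ≤ infPowDist q C₂ x + 1 := by
  rw [← sub_le_iff_le_add]
  refine le_infPowDist hC₂ fun y hy => ?_
  obtain ⟨u, hu, huy⟩ := h₂ y hy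
  rw [sub_le_iff_le_add']
  refine (infPowDist_le huy).trans ?_
  rw [Fin.sum_univ_succAbove _ i]
  simp only [Fin.insertNth_apply_same, Fin.insertNth_apply_succAbove]
  gcongr
  exact Real.rpow_le_one (norm_nonneg _) hu hq

theorem exp_sub_sq_add_exp_neg_le_two {L : ℝ} (h0 : 0 ≤ L) (h1 : L ≤ 1 / 2) :
    Real.exp (L - L ^ 2) + Real.exp (-L) ≤ 2 := by
  set s := L - L ^ 2 / 2 with hs
  have e1 : Real.exp (L - L ^ 2) + Real.exp (-L) =
      Real.exp (-(L ^ 2 / 2)) * (2 * Real.cosh s) := by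
    rw [Real.cosh_eq, mul_div_cancel₀ _ two_ne_zero, mul_add, ← Real.exp_add, ← Real.exp_add]
    congr 2 <;> rw [hs] <;> ring
  have hs0 : 0 ≤ s := by nlinarith
  have hsL : s ≤ L := by nlinarith
  rw [e1]
  calc Real.exp (-(L ^ 2 / 2)) * (2 * Real.cosh s)
      ≤ Real.exp (-(L ^ 2 / 2)) * (2 * Real.exp (L ^ 2 / 2)) := by
        gcongr
        refine (Real.cosh_le_exp_half_sq s).trans ?_
        gcongr
    _ = 2 := by rw [mul_left_comm, ← Real.exp_add]; simp

theorem exp_quarter_le {r : ℝ} (hr : r ≤ Real.exp (-(1 / 2))) : Real.exp (1 / 4) ≤ 2 - r := by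
  have := exp_sub_sq_add_exp_neg_le_two (L := 1 / 2) (by norm_num) le_rfl
  norm_num at this hr ⊢
  linarith

/-- The optimization step in Talagrand's induction. -/
theorem exists_exp_mul_rpow_neg_le {r : ℝ} (h0 : 0 < r) (h1 : r ≤ 1) :
    ∃ a : ℝ, 0 ≤ a ∧ a ≤ 1 ∧ Real.exp ((1 - a) ^ 2 / 4) * r ^ (-a) ≤ 2 - r := by
  rcases le_total r (Real.exp (-(1 / 2))) with hr | hr
  · refine ⟨0, le_rfl, zero_le_one, ?_⟩
    simpa using exp_quarter_le hr
  · have hlog : -(1 / 2) ≤ Real.log r := (Real.le_log_iff_exp_le h0).2 hr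
    have hlog' : Real.log r ≤ 0 := Real.log_nonpos h0.le h1
    refine ⟨1 + 2 * Real.log r, by linarith, by linarith, ?_⟩
    have := exp_sub_sq_add_exp_neg_le_two (L := -Real.log r) (by linarith) (by linarith)
    rw [neg_neg, Real.exp_log h0] at this
    rw [Real.rpow_def_of_pos h0, ← Real.exp_add]
    have e : (1 - (1 + 2 * Real.log r)) ^ 2 / 4 + Real.log r * -(1 + 2 * Real.log r) =
        -Real.log r - (-Real.log r) ^ 2 := by ring
    rw [e]
    linarith

section Fiber

variable {X : Type*} [MeasurableSpace X] {ν : Measure X}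

theorem lintegral_exp_le_of_le_add_one {g h : X → ℝ} {P₀ : ℝ} (hP₀ : 0 < P₀)
    (hg : ∫⁻ x, ENNReal.ofReal (Real.exp (g x / 4)) ∂ν ≤ ENNReal.ofReal P₀⁻¹)
    (hh : ∀ x, h x ≤ g x + 1) :
    ∫⁻ x, ENNReal.ofReal (Real.exp (h x / 4)) ∂ν ≤ ENNReal.ofReal (P₀⁻¹ * 2) := by
  have h2 : Real.exp (1 / 4) ≤ 2 := by simpa using exp_quarter_le (Real.exp_pos _).le
  calc ∫⁻ x, ENNReal.ofReal (Real.exp (h x / 4)) ∂ν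
      ≤ ∫⁻ x, 2 * ENNReal.ofReal (Real.exp (g x / 4)) ∂ν := by
        refine lintegral_mono fun x => ?_
        rw [← ENNReal.ofReal_ofNat 2, ← ENNReal.ofReal_mul (by norm_num)]
        refine ENNReal.ofReal_le_ofReal ?_
        calc Real.exp (h x / 4) ≤ Real.exp (1 / 4 + g x / 4) :=
              Real.exp_le_exp.2 (by linarith [hh x])
          _ ≤ 2 * Real.exp (g x / 4) := by rw [Real.exp_add]; gcongr
    _ = 2 * ∫⁻ x, ENNReal.ofReal (Real.exp (g x / 4)) ∂ν :=
        lintegral_const_mul' _ _ (by simp)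
    _ ≤ 2 * ENNReal.ofReal P₀⁻¹ := by gcongr
    _ = ENNReal.ofReal (P₀⁻¹ * 2) := by
        rw [mul_comm, ENNReal.ofReal_mul (inv_nonneg.2 hP₀.le), ENNReal.ofReal_ofNat]

theorem lintegral_exp_le_of_forall_convexComb {f g h : X → ℝ} (hfm : Measurable f)
    (hgm : Measurable g) {P P₀ : ℝ} (hP : 0 < P) (hPP₀ : P ≤ P₀)
    (hf : ∫⁻ x, ENNReal.ofReal (Real.exp (f x / 4)) ∂ν ≤ ENNReal.ofReal P⁻¹)
    (hg : ∫⁻ x, ENNReal.ofReal (Real.exp (g x / 4)) ∂ν ≤ ENNReal.ofReal P₀⁻¹)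
    (hh : ∀ x (a b : ℝ), 0 ≤ a → 0 ≤ b → a + b = 1 → h x ≤ a * f x + b * g x + b ^ 2) :
    ∫⁻ x, ENNReal.ofReal (Real.exp (h x / 4)) ∂ν ≤ ENNReal.ofReal (P₀⁻¹ * (2 - P / P₀)) := by
  have hP₀ : 0 < P₀ := hP.trans_le hPP₀
  obtain ⟨a, ha0, ha1, ha⟩ := exists_exp_mul_rpow_neg_le (div_pos hP hP₀)
    ((div_le_one hP₀).2 hPP₀)
  have hb0 : 0 ≤ 1 - a := by linarith
  calc ∫⁻ x, ENNReal.ofReal (Real.exp (h x / 4)) ∂ν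
      ≤ ∫⁻ x, ENNReal.ofReal (Real.exp ((1 - a) ^ 2 / 4)) *
          (ENNReal.ofReal (Real.exp (f x / 4)) ^ a *
            ENNReal.ofReal (Real.exp (g x / 4)) ^ (1 - a)) ∂ν := by
        refine lintegral_mono fun x => ?_
        rw [ENNReal.ofReal_rpow_of_pos (Real.exp_pos _),
          ENNReal.ofReal_rpow_of_pos (Real.exp_pos _), ← Real.exp_mul, ← Real.exp_mul,
          ← ENNReal.ofReal_mul (Real.exp_pos _).le, ← ENNReal.ofReal_mul (Real.exp_pos _).le,
          ← Real.exp_add, ← Real.exp_add]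
        refine ENNReal.ofReal_le_ofReal (Real.exp_le_exp.2 ?_)
        linarith [hh x a (1 - a) ha0 hb0 (by ring)]
    _ = ENNReal.ofReal (Real.exp ((1 - a) ^ 2 / 4)) *
          ∫⁻ x, ENNReal.ofReal (Real.exp (f x / 4)) ^ a *
            ENNReal.ofReal (Real.exp (g x / 4)) ^ (1 - a) ∂ν :=
        lintegral_const_mul' _ _ ENNReal.ofReal_ne_top
    _ ≤ ENNReal.ofReal (Real.exp ((1 - a) ^ 2 / 4)) *
          ((∫⁻ x, ENNReal.ofReal (Real.exp (f x / 4)) ∂ν) ^ a *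
            (∫⁻ x, ENNReal.ofReal (Real.exp (g x / 4)) ∂ν) ^ (1 - a)) := by
        gcongr
        exact ENNReal.lintegral_mul_norm_pow_le (by fun_prop) (by fun_prop) ha0 hb0 (by ring)
    _ ≤ ENNReal.ofReal (Real.exp ((1 - a) ^ 2 / 4)) *
          (ENNReal.ofReal P⁻¹ ^ a * ENNReal.ofReal P₀⁻¹ ^ (1 - a)) := by
        gcongr
    _ = ENNReal.ofReal (P₀⁻¹ * (Real.exp ((1 - a) ^ 2 / 4) * (P / P₀) ^ (-a))) := by
        rw [ENNReal.ofReal_rpow_of_pos (inv_pos.2 hP), ENNReal.ofReal_rpow_of_pos (inv_pos.2 hP₀),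
          ← ENNReal.ofReal_mul (by positivity), ← ENNReal.ofReal_mul (by positivity)]
        congr 1
        rw [Real.div_rpow hP.le hP₀.le, Real.rpow_sub (inv_pos.2 hP₀), Real.rpow_one,
          Real.inv_rpow hP.le, Real.inv_rpow hP₀.le, Real.rpow_neg hP.le, Real.rpow_neg hP₀.le]
        have := (Real.rpow_pos_of_pos hP a).ne'
        have := (Real.rpow_pos_of_pos hP₀ a).ne'
        field_simp
    _ ≤ ENNReal.ofReal (P₀⁻¹ * (2 - P / P₀)) := by
        gcongr

end Fiber

theorem lintegral_inv_mul_two_sub_le {X : Type*} [MeasurableSpace X] {ν : Measure X}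
    [IsProbabilityMeasure ν] {p : X → ℝ} {P₀ : ℝ} (hp : Integrable p ν) (hP₀ : 0 < P₀)
    (hpP₀ : ∀ x, p x ≤ P₀) (hpos : 0 < ∫ x, p x ∂ν) :
    ∫⁻ x, ENNReal.ofReal (P₀⁻¹ * (2 - p x / P₀)) ∂ν ≤ ENNReal.ofReal (∫ x, p x ∂ν)⁻¹ := by
  have hint : Integrable (fun x => P₀⁻¹ * (2 - p x / P₀)) ν :=
    ((integrable_const _).sub (hp.div_const _)).const_mul _
  rw [← ofReal_integral_eq_lintegral_ofReal hint]
  · refine ENNReal.ofReal_le_ofReal ?_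
    rw [integral_const_mul, integral_sub (integrable_const _) (hp.div_const _), integral_div]
    simp only [integral_const, probReal_univ, one_smul]
    set I := ∫ x, p x ∂ν
    rw [← sub_nonneg]
    have : I⁻¹ - P₀⁻¹ * (2 - I / P₀) = (P₀ - I) ^ 2 / (I * P₀ ^ 2) := by
      field_simp
      ring
    rw [this]
    positivity
  · refine Filter.Eventually.of_forall fun x => ?_
    have : p x / P₀ ≤ 1 := (div_le_one hP₀).2 (hpP₀ x)
    have : 0 ≤ P₀⁻¹ := (inv_pos.2 hP₀).le
    exact mul_nonneg this (by linarith)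

/-- **Talagrand's convex distance inequality** for the `ℓ_q`-distance. -/
theorem lintegral_exp_infPowDist_convexHull_le {q : ℝ} (hq : 2 ≤ q) {n : ℕ}
    {V K : Fin n → Type*} [∀ j, NormedAddCommGroup (V j)] [∀ j, NormedSpace ℝ (V j)]
    [∀ j, TopologicalSpace (K j)] [∀ j, CompactSpace (K j)] [∀ j, T2Space (K j)]
    [∀ j, SecondCountableTopology (K j)] [∀ j, MeasurableSpace (K j)] [∀ j, BorelSpace (K j)]
    (ν : ∀ j, Measure (K j)) [∀ j, IsProbabilityMeasure (ν j)] (φ : ∀ j, K j → V j)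
    (hφ : ∀ j, Continuous (φ j)) (hdiam : ∀ j x y, ‖φ j x - φ j y‖ ≤ 1)
    {B : Set (∀ j, K j)} (hB : IsClosed B) (hne : B.Nonempty) :
    ∫⁻ x, ENNReal.ofReal (Real.exp
      (infPowDist q (convexHull ℝ (Pi.map φ '' B)) (Pi.map φ x) / 4)) ∂Measure.pi ν ≤
        (Measure.pi ν B)⁻¹ := by
  induction n with
  | zero =>
    have hB1 : B = univ := Subsingleton.eq_univ_of_nonempty hne
    have h0 : ∀ (C : Set (∀ j, V j)) x, infPowDist q C x = 0 := by
      intro C x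
      simp [infPowDist]
    simp [h0, hB1]
  | succ n ih =>
    set C := convexHull ℝ (Pi.map φ '' B)
    rcases eq_or_ne (Measure.pi ν B) 0 with hB0 | hB0
    · simp [hB0]
    let ν' := fun j => ν ((0 : Fin (n + 1)).succAbove j)
    let φ' := fun j => φ ((0 : Fin (n + 1)).succAbove j)
    let sec : K 0 → Set (∀ j, K ((0 : Fin (n + 1)).succAbove j)) := fun w =>
      {x | ((0 : Fin (n + 1)).insertNth w x : ∀ j, K j) ∈ B}
    let proj : Set (∀ j, K ((0 : Fin (n + 1)).succAbove j)) :=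
      (fun x j => x ((0 : Fin (n + 1)).succAbove j)) '' B
    have hins : ∀ w x, Pi.map φ ((0 : Fin (n + 1)).insertNth w x) =
        (0 : Fin (n + 1)).insertNth (φ 0 w) (Pi.map φ' x) :=
      fun w x => piMap_insertNth 0 φ w x
    have hsec_sub : ∀ w, sec w ⊆ proj := fun w x hx => ⟨_, hx,
      funext fun j => Fin.insertNth_apply_succAbove ..⟩
    have hsec_closed : ∀ w, IsClosed (sec w) := fun w =>
      hB.preimage (continuous_const.finInsertNth 0 continuous_id)
    have hproj_closed : IsClosed proj :=
      (hB.isCompact.image (by fun_prop)).isClosed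
    have hproj_ne : proj.Nonempty := hne.image _
    have hmp := measurePreserving_piFinSuccAbove ν 0
    have hmp' := hmp.symm
    have hBprod : Measure.pi ν B = ∫⁻ w, Measure.pi ν' (sec w) ∂ν 0 := by
      rw [← hmp'.measure_preimage_equiv, Measure.prod_apply]
      · rfl
      · exact (MeasurableEquiv.measurable _) hB.measurableSet
    let p : K 0 → ℝ := fun w => (Measure.pi ν').real (sec w)
    have hpm : Measurable fun w => Measure.pi ν' (sec w) :=
      measurable_measure_prodMk_left
        ((MeasurableEquiv.piFinSuccAbove K 0).symm.measurable hB.measurableSet)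
    have hpi : Integrable p (ν 0) := by
      refine Integrable.of_bound hpm.ennreal_toReal.aestronglyMeasurable 1 ?_
      refine Filter.Eventually.of_forall fun w => ?_
      rw [Real.norm_of_nonneg measureReal_nonneg]
      exact measureReal_le_one
    have hBint : Measure.pi ν B = ENNReal.ofReal (∫ w, p w ∂ν 0) := by
      rw [ofReal_integral_eq_lintegral_ofReal hpi
        (Filter.Eventually.of_forall fun w => measureReal_nonneg), hBprod]
      exact lintegral_congr fun w => (ofReal_measureReal (measure_ne_top _ _)).symm
    have hIpos : 0 < ∫ w, p w ∂ν 0 := by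
      by_contra! h
      exact hB0 (by rw [hBint, ENNReal.ofReal_of_nonpos h])
    set P₀ := (Measure.pi ν').real proj
    have hpP₀ : ∀ w, p w ≤ P₀ := fun w => measureReal_mono (hsec_sub w)
    have hP₀ : 0 < P₀ := by
      by_contra! h
      exact hIpos.not_ge (integral_nonpos fun w => (hpP₀ w).trans h)
    have hinv : ∀ S, 0 < (Measure.pi ν').real S →
        (Measure.pi ν' S)⁻¹ = ENNReal.ofReal ((Measure.pi ν').real S)⁻¹ := by
      intro S hS
      rw [ENNReal.ofReal_inv_of_pos hS, ofReal_measureReal]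
    have hCconv : Convex ℝ C := convex_convexHull ℝ _
    have hproj_mem : ∀ y ∈ convexHull ℝ (Pi.map φ' '' proj), ∃ u ∈ convexHull ℝ (range (φ 0)),
        ((0 : Fin (n + 1)).insertNth u y : ∀ j, V j) ∈ C := by
      refine convexHull_min ?_ ?_
      · rintro _ ⟨_, ⟨x, hx, rfl⟩, rfl⟩
        refine ⟨φ 0 (x 0), subset_convexHull ℝ _ ⟨_, rfl⟩, ?_⟩
        rw [← hins]
        refine subset_convexHull ℝ _ ⟨x, hx, ?_⟩
        congr 1
        exact (Fin.insertNth_self_removeNth 0 x).symm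
      · rintro y ⟨u, hu, huy⟩ z ⟨v, hv, hvz⟩ a b ha hb hab
        refine ⟨a • u + b • v, convex_convexHull ℝ _ hu hv ha hb hab, ?_⟩
        rw [insertNth_convexComb]
        exact hCconv huy hvz ha hb hab
    have hsec_mem : ∀ w, ∀ y ∈ convexHull ℝ (Pi.map φ' '' sec w),
        ((0 : Fin (n + 1)).insertNth (φ 0 w) y : ∀ j, V j) ∈ C := by
      intro w
      refine convexHull_min (t := {y | ((0 : Fin (n + 1)).insertNth (φ 0 w) y : ∀ j, V j) ∈ C}) ?_ ?_
      · rintro _ ⟨x, hx, rfl⟩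
        rw [mem_ofPred_eq, ← hins]
        exact subset_convexHull ℝ _ ⟨_, hx, rfl⟩
      · intro y hy z hz a b ha hb hab
        have := hCconv hy hz ha hb hab
        rwa [← insertNth_convexComb, ← add_smul, hab, one_smul] at this
    have hnear : ∀ w, ∀ u ∈ convexHull ℝ (range (φ 0)), ‖φ 0 w - u‖ ≤ 1 := by
      intro w u hu
      have : convexHull ℝ (range (φ 0)) ⊆ Metric.closedBall (φ 0 w) 1 := by
        refine convexHull_min ?_ (convex_closedBall _ _)
        rintro _ ⟨x, rfl⟩
        rw [Metric.mem_closedBall, dist_eq_norm]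
        exact hdiam 0 x w
      rw [← dist_eq_norm, dist_comm]
      exact this hu
    have hproj_mem' : ∀ w, ∀ y ∈ convexHull ℝ (Pi.map φ' '' proj), ∃ u, ‖φ 0 w - u‖ ≤ 1 ∧
        ((0 : Fin (n + 1)).insertNth u y : ∀ j, V j) ∈ C := fun w y hy =>
      let ⟨u, hu, huy⟩ := hproj_mem y hy
      ⟨u, hnear w u hu, huy⟩
    have hprojC_ne : (convexHull ℝ (Pi.map φ' '' proj)).Nonempty := (hproj_ne.image _).convexHull
    have hφ'c : Continuous (Pi.map φ') := Continuous.piMap fun j => hφ _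
    have hφc : Continuous (Pi.map φ) := Continuous.piMap hφ
    have hmeas : ∀ D, Measurable fun x => infPowDist q D (Pi.map φ' x) := fun D =>
      measurable_infPowDist_comp (by linarith) D hφ'c
    have hg := ih ν' φ' (fun j => hφ _) (fun j => hdiam _) hproj_closed hproj_ne
    rw [hinv _ hP₀] at hg
    have hfiber : ∀ w, ∫⁻ x, ENNReal.ofReal (Real.exp (infPowDist q C
        (Pi.map φ ((0 : Fin (n + 1)).insertNth w x)) / 4)) ∂Measure.pi ν' ≤
        ENNReal.ofReal (P₀⁻¹ * (2 - p w / P₀)) := by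
      intro w
      simp only [hins]
      have hp0 : 0 ≤ p w := measureReal_nonneg
      rcases hp0.eq_or_lt with hpw | hpw
      · rw [← hpw, zero_div, sub_zero]
        refine lintegral_exp_le_of_le_add_one hP₀ hg fun x => ?_
        exact infPowDist_insertNth_le_add_one (by linarith) 0 hprojC_ne (hproj_mem' w) _
      · have hsec_ne : (sec w).Nonempty := by
          by_contra! h
          refine hpw.ne' ?_
          simp only [p, h]
          exact measureReal_empty
        have hf := ih ν' φ' (fun j => hφ _) (fun j => hdiam _) (hsec_closed w) hsec_ne
        rw [hinv _ hpw] at hf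
        exact lintegral_exp_le_of_forall_convexComb (hmeas _) (hmeas _) hpw (hpP₀ w) hf hg
          fun x a b ha hb hab => infPowDist_insertNth_le hq 0 hCconv
            ((hsec_ne.image _).convexHull) hprojC_ne (hsec_mem w) (hproj_mem' w) _ ha hb hab
    have hmeasB : Measurable fun x => ENNReal.ofReal (Real.exp
        (infPowDist q C (Pi.map φ x) / 4)) := by
      have := measurable_infPowDist_comp (q := q) (by linarith) C hφc
      fun_prop
    calc ∫⁻ x, ENNReal.ofReal (Real.exp (infPowDist q C (Pi.map φ x) / 4)) ∂Measure.pi ν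
        = ∫⁻ w, ∫⁻ x, ENNReal.ofReal (Real.exp (infPowDist q C
            (Pi.map φ ((0 : Fin (n + 1)).insertNth w x)) / 4)) ∂Measure.pi ν' ∂ν 0 := by
          rw [← hmp'.lintegral_comp hmeasB, lintegral_prod]
          · rfl
          · exact (hmeasB.comp (MeasurableEquiv.measurable _)).aemeasurable
      _ ≤ ∫⁻ w, ENNReal.ofReal (P₀⁻¹ * (2 - p w / P₀)) ∂ν 0 := lintegral_mono hfiber
      _ ≤ ENNReal.ofReal (∫ w, p w ∂ν 0)⁻¹ := lintegral_inv_mul_two_sub_le hpi hP₀ hpP₀ hIpos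
      _ = (Measure.pi ν B)⁻¹ := by rw [hBint, ENNReal.ofReal_inv_of_pos hIpos]

theorem measure_pi_le_mul_measure_pi_ge_le {q : ℝ} (hq : 2 ≤ q) {n : ℕ}
    {V K : Fin n → Type*} [∀ j, NormedAddCommGroup (V j)] [∀ j, NormedSpace ℝ (V j)]
    [∀ j, TopologicalSpace (K j)] [∀ j, CompactSpace (K j)] [∀ j, T2Space (K j)]
    [∀ j, SecondCountableTopology (K j)] [∀ j, MeasurableSpace (K j)] [∀ j, BorelSpace (K j)]
    (ν : ∀ j, Measure (K j)) [∀ j, IsProbabilityMeasure (ν j)] (φ : ∀ j, K j → V j)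
    (hφ : ∀ j, Continuous (φ j)) (hdiam : ∀ j x y, ‖φ j x - φ j y‖ ≤ 1)
    {F : (∀ j, V j) → ℝ}
    (hLip : ∀ x y : ∀ j, V j, |F x - F y| ≤ (∑ j, ‖x j - y j‖ ^ q) ^ (1 / q))
    (hqc : ∀ a : ℝ, Convex ℝ {x : ∀ j, V j | F x ≤ a}) (a : ℝ) {t : ℝ} (ht : 0 < t) :
    Measure.pi ν {x | F (Pi.map φ x) ≤ a} * Measure.pi ν {x | a + t ≤ F (Pi.map φ x)} ≤
      ENNReal.ofReal (Real.exp (-(t ^ q) / 4)) := by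
  have hq0 : 0 < q := by linarith
  have hφc : Continuous (Pi.map φ) := Continuous.piMap hφ
  have hFc : Continuous F := by
    refine continuous_iff_continuousAt.2 fun y => ?_
    rw [ContinuousAt, tendsto_iff_dist_tendsto_zero]
    refine squeeze_zero (fun _ => dist_nonneg)
      (fun x => (Real.dist_eq (F x) (F y)).le.trans (hLip x y)) ?_
    have hcont : Continuous fun x : ∀ j, V j => (∑ j, ‖x j - y j‖ ^ q) ^ (1 / q) :=
      Continuous.rpow_const (continuous_finsetSum _ fun j _ =>
        Continuous.rpow_const (by fun_prop) fun _ => Or.inr hq0.le)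
        fun _ => Or.inr (by positivity)
    have h0 : (0 : ℝ) = (∑ j, ‖y j - y j‖ ^ q) ^ (1 / q) := by
      simp [Real.zero_rpow hq0.ne', Real.zero_rpow (inv_ne_zero hq0.ne')]
    rw [h0]
    exact hcont.tendsto y
  set B := {x | F (Pi.map φ x) ≤ a}
  have hB : IsClosed B := isClosed_le (hFc.comp hφc) continuous_const
  rcases B.eq_empty_or_nonempty with hB0 | hne
  · simp [hB0]
  set D := fun x => infPowDist q (convexHull ℝ (Pi.map φ '' B)) (Pi.map φ x)
  have hDm : Measurable D := measurable_infPowDist_comp hq0.le _ hφc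
  have hsub : {x | a + t ≤ F (Pi.map φ x)} ⊆ {x | ENNReal.ofReal (Real.exp (t ^ q / 4)) ≤
      ENNReal.ofReal (Real.exp (D x / 4))} := by
    intro x (hx : a + t ≤ F (Pi.map φ x))
    have hle : t ^ q ≤ D x := by
      refine le_infPowDist (hne.image _).convexHull fun y hy => ?_
      have hy' : F y ≤ a := by
        refine convexHull_min (t := {y | F y ≤ a}) ?_ (hqc a) hy
        rintro _ ⟨z, hz, rfl⟩
        exact hz
      have h1 : t ≤ (∑ j, ‖Pi.map φ x j - y j‖ ^ q) ^ (1 / q) :=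
        le_trans (by linarith) ((le_abs_self _).trans (hLip (Pi.map φ x) y))
      refine (Real.rpow_le_rpow ht.le h1 hq0.le).trans_eq ?_
      rw [one_div, Real.rpow_inv_rpow (by positivity) hq0.ne']
    refine ENNReal.ofReal_le_ofReal (Real.exp_le_exp.2 ?_)
    linarith
  have hint := lintegral_exp_infPowDist_convexHull_le hq ν φ hφ hdiam hB hne
  have hmarkov := meas_ge_le_lintegral_div (μ := Measure.pi ν)
    (f := fun x => ENNReal.ofReal (Real.exp (D x / 4))) (by fun_prop)
    (ε := ENNReal.ofReal (Real.exp (t ^ q / 4)))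
    (ENNReal.ofReal_pos.2 (Real.exp_pos _)).ne' ENNReal.ofReal_ne_top
  calc Measure.pi ν B * Measure.pi ν {x | a + t ≤ F (Pi.map φ x)}
      ≤ Measure.pi ν B * ((Measure.pi ν B)⁻¹ / ENNReal.ofReal (Real.exp (t ^ q / 4))) := by
        gcongr
        exact (measure_mono hsub).trans (hmarkov.trans (by gcongr))
    _ = Measure.pi ν B * (Measure.pi ν B)⁻¹ * ENNReal.ofReal (Real.exp (-(t ^ q) / 4)) := by
        rw [div_eq_mul_inv, ← mul_assoc, ← ENNReal.ofReal_inv_of_pos (Real.exp_pos _),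
          ← Real.exp_neg, neg_div]
    _ ≤ 1 * ENNReal.ofReal (Real.exp (-(t ^ q) / 4)) := by
        gcongr
        exact ENNReal.mul_inv_le_one _
    _ = ENNReal.ofReal (Real.exp (-(t ^ q) / 4)) := one_mul _

theorem measurableEmbedding_piMap {ι : Type*} [Countable ι] {X Y : ι → Type*}
    [∀ j, MeasurableSpace (X j)] [∀ j, MeasurableSpace (Y j)] [∀ j, Nonempty (X j)]
    {f : ∀ j, X j → Y j} (hf : ∀ j, MeasurableEmbedding (f j)) :
    MeasurableEmbedding (Pi.map f) := by
  refine MeasurableEmbedding.of_measurable_inverse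
    (g := Pi.map fun j => (hf j).invFun) ?_ ?_ ?_ ?_
  · exact measurable_pi_lambda _ fun j => (hf j).measurable.comp (measurable_pi_apply j)
  · rw [range_piMap]
    exact MeasurableSet.univ_pi fun j => (hf j).measurableSet_range
  · exact measurable_pi_lambda _ fun j =>
      (hf j).measurable_invFun.comp (measurable_pi_apply j)
  · exact fun x => funext fun j => (hf j).leftInverse_invFun (x j)

theorem ENNReal.le_two_mul_of_half_le_of_mul_le {a b c : ENNReal} (ha : 1 / 2 ≤ a)
    (h : a * b ≤ c) : b ≤ 2 * c := by
  calc b = 2 * (1 / 2 * b) := by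
        rw [← mul_assoc, one_div, ENNReal.mul_inv_cancel two_ne_zero ENNReal.ofNat_ne_top, one_mul]
    _ ≤ 2 * c := by
        gcongr
        exact le_trans (by gcongr) h

/-- Concentration for quasiconvex functions which are `1`-Lipschitz with
respect to the `ℓ_q`-sum norm (`q ≥ 2`) on a product of normed spaces, under a product of
compactly supported probability measures on the factors, with support sets of diameter
at most `1`. -/
theorem lq_sum_concentration {N : ℕ} (q : ℝ) (hq : 2 ≤ q)
    (V : Fin N → Type*) [∀ j, NormedAddCommGroup (V j)] [∀ j, NormedSpace ℝ (V j)]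
    [∀ j, MeasurableSpace (V j)] [∀ j, BorelSpace (V j)]
    (μ : ∀ j, Measure (V j)) [∀ j, IsProbabilityMeasure (μ j)]
    (hsupp : ∀ j, ∃ s : Set (V j), IsCompact s ∧ Metric.diam s ≤ 1 ∧ μ j s = 1)
    (F : (∀ j, V j) → ℝ)
    (hLip : ∀ x y : ∀ j, V j, |F x - F y| ≤ (∑ j, ‖x j - y j‖ ^ q) ^ (1 / q))
    (hqc : ∀ a : ℝ, Convex ℝ {x : ∀ j, V j | F x ≤ a})
    (M : ℝ) (hM : IsMedian (Measure.pi μ) F M)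
    (t : ℝ) (ht : 0 < t) :
    Measure.pi μ {x | t ≤ |F x - M|} ≤ ENNReal.ofReal (4 * Real.exp (-(t ^ q) / 4)) := by
  choose s hs hsd hs1 using hsupp
  let K : Fin N → Type _ := fun j => s j
  have : ∀ j, CompactSpace (K j) := fun j => isCompact_iff_compactSpace.1 (hs j)
  have : ∀ j, SecondCountableTopology (K j) := fun j =>
    UniformSpace.secondCountable_of_separable (K j)
  let φ : ∀ j, K j → V j := fun j => Subtype.val
  have hemb : ∀ j, MeasurableEmbedding (φ j) := fun j =>
    MeasurableEmbedding.subtype_coe (hs j).measurableSet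
  let ν : ∀ j, Measure (K j) := fun j => (μ j).comap (φ j)
  have hmap : ∀ j, (ν j).map (φ j) = μ j := by
    intro j
    have h := map_comap_subtype_coe (hs j).measurableSet (μ j)
    refine h.trans (Measure.restrict_eq_self_of_ae_mem ?_)
    exact (prob_compl_eq_zero_iff (hs j).measurableSet).2 (hs1 j)
  have hν : ∀ j, IsProbabilityMeasure (ν j) := fun j => by
    refine ⟨?_⟩
    rw [← preimage_univ (f := φ j), ← (hemb j).map_apply, hmap, measure_univ]
  have hne : ∀ j, Nonempty (K j) := fun j => (ν j).nonempty_of_neZero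
  have hdiam : ∀ j x y, ‖φ j x - φ j y‖ ≤ 1 := fun j x y => by
    rw [← dist_eq_norm]
    exact (Metric.dist_le_diam_of_mem (hs j).isBounded x.2 y.2).trans (hsd j)
  have hpi : ∀ S, Measure.pi μ S = Measure.pi ν (Pi.map φ ⁻¹' S) := fun S => by
    have : ∀ j, SigmaFinite ((ν j).map (φ j)) := fun j => by rw [hmap]; infer_instance
    have h := Measure.pi_map_pi (μ := ν) (f := φ) fun j => (hemb j).measurable.aemeasurable
    simp only [hmap] at h
    rw [← h]
    exact (measurableEmbedding_piMap hemb).map_apply _ S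
  have htail := fun a => measure_pi_le_mul_measure_pi_ge_le hq ν φ
    (fun j => continuous_subtype_val) hdiam hLip hqc a ht
  obtain ⟨hM1, hM2⟩ := hM
  rw [hpi] at hM1 hM2
  have hupper := ENNReal.le_two_mul_of_half_le_of_mul_le hM1 (htail M)
  have hlow := htail (M - t)
  rw [sub_add_cancel, mul_comm] at hlow
  have hlower := ENNReal.le_two_mul_of_half_le_of_mul_le hM2 hlow
  have hsub : Pi.map φ ⁻¹' {x | t ≤ |F x - M|} ⊆
      {x | M + t ≤ F (Pi.map φ x)} ∪ {x | F (Pi.map φ x) ≤ M - t} := by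
    intro x (hx : t ≤ |F (Pi.map φ x) - M|)
    rcases le_abs.1 hx with h | h
    · left
      change M + t ≤ F (Pi.map φ x)
      linarith
    · right
      change F (Pi.map φ x) ≤ M - t
      linarith
  calc Measure.pi μ {x | t ≤ |F x - M|}
      ≤ Measure.pi ν {x | M + t ≤ F (Pi.map φ x)} +
          Measure.pi ν {x | F (Pi.map φ x) ≤ M - t} := by
        rw [hpi]
        exact (measure_mono hsub).trans (measure_union_le _ _)
    _ ≤ 2 * ENNReal.ofReal (Real.exp (-(t ^ q) / 4)) +
          2 * ENNReal.ofReal (Real.exp (-(t ^ q) / 4)) := add_le_add hupper hlower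
    _ = ENNReal.ofReal (4 * Real.exp (-(t ^ q) / 4)) := by
        rw [← add_mul, ENNReal.ofReal_mul (by norm_num)]
        norm_num
end

section
/- Let p ≥ 1, let w = (w₁, w₂, …) be a nonincreasing sequence of positive numbers, and suppose w ∈ ℓ_r for some r with max{1, 2/p} ≤ r' < ∞, where r' = r/(r−1). Let ℓ_{w,p}^N denote ℝ^N with the Lorentz norm ‖x‖_{w,p} = ( Σ_{j=1}^N w_j a_j^p )^{1/p}, where (a_j) is the nonincreasing rearrangement of (|x_j|). Then for all t > 0, K_{ℓ_{w,p}^N}(t) ≥ ‖w‖_r^{−r'/2} · t^{p r'/2}, where K_E(t) = inf{ |x| : ‖x‖_E ≥ t, ‖x‖_∞ ≤ 1 } and |·| is the Euclidean norm on ℝ^N. -/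
/-- The nonincreasing rearrangement of the absolute values of the coordinates of
`x : ℝ^N`: `decRearrange x j` is the `(j+1)`-th largest among `|x 0|, …, |x (N-1)|`. -/
noncomputable def decRearrange {N : ℕ} (x : Fin N → ℝ) (j : Fin N) : ℝ :=
  |x (Tuple.sort (fun i => |x i|) j.rev)|

/-- The nonincreasing rearrangement has the same symmetric sums as `|x|`. -/
lemma sum_comp_decRearrange {N : ℕ} (x : Fin N → ℝ) (f : ℝ → ℝ) :
    ∑ j, f (decRearrange x j) = ∑ j, f |x j| :=
  Equiv.sum_comp (Fin.revPerm.trans (Tuple.sort fun i => |x i|)) fun j => f |x j|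

/-- Hölder's inequality for the Lorentz functional, combined with `a ^ (p * q) ≤ a ^ 2` on
`[0, 1]`. -/
lemma lorentz_sum_le {N : ℕ} {p r q : ℝ} (hrq : r.HolderConjugate q) (hpq : 2 ≤ p * q)
    {w : ℕ → ℝ} (hw : ∀ j, 0 < w j) (hw_sum : Summable fun j => w j ^ r)
    {x : Fin N → ℝ} (hx : ∀ j, |x j| ≤ 1) :
    ∑ j : Fin N, w j.1 * decRearrange x j ^ p ≤
      (∑' j, w j ^ r) ^ (1 / r) * (∑ j, x j ^ 2) ^ (1 / q) := by
  have hr := hrq.pos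
  have hq := hrq.symm.pos
  have ha : ∀ j, 0 ≤ decRearrange x j := fun j => abs_nonneg _
  refine (Real.inner_le_Lp_mul_Lq_of_nonneg Finset.univ hrq (fun j _ => (hw j.1).le)
    fun j _ => Real.rpow_nonneg (ha j) p).trans ?_
  have hW : ∑ j : Fin N, w j.1 ^ r ≤ ∑' j, w j ^ r := by
    rw [Fin.sum_univ_eq_sum_range fun j => w j ^ r]
    exact hw_sum.sum_le_tsum _ fun j _ => Real.rpow_nonneg (hw j).le r
  have hX : ∑ j, (decRearrange x j ^ p) ^ q ≤ ∑ j, x j ^ 2 := by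
    rw [sum_comp_decRearrange x fun a => (a ^ p) ^ q]
    refine Finset.sum_le_sum fun j _ => ?_
    rw [← Real.rpow_mul (abs_nonneg _), ← sq_abs (x j), ← Real.rpow_natCast]
    exact Real.rpow_le_rpow_of_exponent_ge_of_imp (abs_nonneg _) (hx j) (by exact_mod_cast hpq)
      fun _ h => by linarith
  have hW0 : 0 ≤ ∑ j : Fin N, w j.1 ^ r :=
    Finset.sum_nonneg fun j _ => Real.rpow_nonneg (hw j).le r
  have hX0 : 0 ≤ ∑ j, (decRearrange x j ^ p) ^ q :=
    Finset.sum_nonneg fun j _ => Real.rpow_nonneg (Real.rpow_nonneg (ha j) p) q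
  have hW1 := hW0.trans hW
  gcongr


/-- Lower bound for `K_E` when `E = ℓ_{w,p}^N` is a Lorentz space:
for every `t > 0` and every `x` with `‖x‖_{w,p} ≥ t` and `‖x‖_∞ ≤ 1` one has
`|x| ≥ ‖w‖_r^{-r'/2} t^{p r'/2}` (which is exactly
`K_{ℓ_{w,p}^N}(t) ≥ ‖w‖_r^{-r'/2} t^{p r'/2}` with the convention `inf ∅ = ∞`). -/
theorem lorentz_KE_lower_bound {N : ℕ} (p r : ℝ) (hp : 1 ≤ p) (hr : 1 < r)
    (w : ℕ → ℝ) (hw_pos : ∀ j, 0 < w j) (hw_anti : Antitone w)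
    (hw_sum : Summable fun j => w j ^ r)
    (hr' : max 1 (2 / p) ≤ r / (r - 1))
    (t : ℝ) (ht : 0 < t)
    (x : Fin N → ℝ)
    (hxE : t ≤ (∑ j : Fin N, w j.1 * decRearrange x j ^ p) ^ (1 / p))
    (hx_inf : ∀ j, |x j| ≤ 1) :
    ((∑' j, w j ^ r) ^ (1 / r)) ^ (-(r / (r - 1)) / 2) * t ^ (p * (r / (r - 1)) / 2)
      ≤ Real.sqrt (∑ j, x j ^ 2) := by
  have hrq : r.HolderConjugate (r / (r - 1)) := Real.HolderConjugate.conjExponent hr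
  have hp0 : 0 < p := by linarith
  have hpq : 2 ≤ p * (r / (r - 1)) := by
    have := (le_max_right _ _).trans hr'
    rwa [div_le_iff₀' hp0] at this
  have hS0 : 0 ≤ ∑ j : Fin N, w j.1 * decRearrange x j ^ p :=
    Finset.sum_nonneg fun j _ => mul_nonneg (hw_pos j).le (Real.rpow_nonneg (abs_nonneg _) p)
  have hle := lorentz_sum_le hrq hpq hw_pos hw_sum hx_inf
  set q := r / (r - 1)
  have hq : 0 < q := hrq.symm.pos
  have hA : 0 < (∑' j, w j ^ r) ^ (1 / r) :=
    Real.rpow_pos_of_pos (hw_sum.tsum_pos (fun j => Real.rpow_nonneg (hw_pos j).le r) 0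
      (Real.rpow_pos_of_pos (hw_pos 0) r)) _
  set A := (∑' j, w j ^ r) ^ (1 / r)
  have hX0 : 0 ≤ ∑ j, x j ^ 2 := Finset.sum_nonneg fun j _ => sq_nonneg _
  have htp : t ^ p ≤ A * (∑ j, x j ^ 2) ^ (1 / q) := by
    rw [one_div, Real.le_rpow_inv_iff_of_pos ht.le hS0 hp0] at hxE
    exact hxE.trans hle
  calc A ^ (-q / 2) * t ^ (p * q / 2)
      = A ^ (-q / 2) * (t ^ p) ^ (q / 2) := by rw [← Real.rpow_mul ht.le, mul_div_assoc]
    _ ≤ A ^ (-q / 2) * (A * (∑ j, x j ^ 2) ^ (1 / q)) ^ (q / 2) := by gcongr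
    _ = √(∑ j, x j ^ 2) := by
      rw [Real.mul_rpow hA.le (Real.rpow_nonneg hX0 _), ← mul_assoc, ← Real.rpow_add hA,
        ← Real.rpow_mul hX0, Real.sqrt_eq_rpow, show -q / 2 + q / 2 = 0 by ring,
        Real.rpow_zero, one_mul, show 1 / q * (q / 2) = 1 / 2 by field_simp]
end

section
/- Let ψ : [0,∞) → [0,∞) be an Orlicz function, that is, a convex nondecreasing function with ψ(0) = 0 and ψ(t) → ∞ as t → ∞. Let ℓ_ψ^N denote ℝ^N with the Orlicz norm ‖x‖_ψ = inf{ ρ > 0 : Σ_{j=1}^N ψ(|x_j|/ρ) ≤ 1 }. Then for all t > 0, K_{ℓ_ψ^N}(t) ≥ inf_{0 < u ≤ 1} u / √(ψ(u/t)), where K_E(t) = inf{ |x| : ‖x‖_E ≥ t, ‖x‖_∞ ≤ 1 } and |·| is the Euclidean norm on ℝ^N. -/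
open scoped ENNReal

/-- If the modular of `x` at scale `t` is less than `1`, then it is at most `1` at some smaller
scale. -/
lemma ConvexOn.exists_lt_sum_div_le_one {ι : Type*} [Fintype ι] {ψ : ℝ → ℝ}
    (hψ : ConvexOn ℝ (Set.Ici 0) ψ) {t : ℝ} (ht : 0 < t) (x : ι → ℝ)
    (h : ∑ j, ψ (|x j| / t) < 1) :
    ∃ ρ, 0 < ρ ∧ ρ < t ∧ ∑ j, ψ (|x j| / ρ) ≤ 1 := by
  set A := ∑ j, ψ (|x j| / t) with hA
  set B := ∑ j, ψ (2 * (|x j| / t)) with hB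
  obtain ⟨ε, hε0, hε1, hε⟩ : ∃ ε : ℝ, 0 < ε ∧ ε ≤ 1 ∧ (1 - ε) * A + ε * B ≤ 1 := by
    have hD : 0 < 1 - A + |B - A| := by linarith [abs_nonneg (B - A)]
    refine ⟨(1 - A) / (1 - A + |B - A|), div_pos (by linarith) hD,
      (div_le_one hD).2 (by linarith [abs_nonneg (B - A)]), ?_⟩
    have hle : (1 - A) / (1 - A + |B - A|) * (B - A) ≤ 1 - A := by
      rw [div_mul_eq_mul_div, div_le_iff₀ hD]
      exact mul_le_mul_of_nonneg_left (by linarith [le_abs_self (B - A)]) (by linarith)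
    linarith
  refine ⟨t / (1 + ε), by positivity, div_lt_self ht (by linarith), ?_⟩
  refine le_trans ?_ hε
  rw [hA, hB, Finset.mul_sum, Finset.mul_sum, ← Finset.sum_add_distrib]
  refine Finset.sum_le_sum fun j _ => ?_
  have hs : 0 ≤ |x j| / t := by positivity
  have hc := hψ.2 (Set.mem_Ici.2 hs) (Set.mem_Ici.2 (mul_nonneg zero_le_two hs))
    (sub_nonneg.2 hε1) hε0.le (by ring)
  simp only [smul_eq_mul] at hc
  convert hc using 2
  field_simp
  ring

/-- Lower bound for `K_E` when `E = ℓ_ψ^N` is an Orlicz space: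
for every `t > 0` and every `x` with `‖x‖_ψ ≥ t` and `‖x‖_∞ ≤ 1` one has
`|x| ≥ inf_{0 < u ≤ 1} u / √(ψ(u/t))` (which is exactly
`K_{ℓ_ψ^N}(t) ≥ inf_{0 < u ≤ 1} u / √(ψ(u/t))` with the convention `inf ∅ = ∞`).
The infimum is taken in `ℝ≥0∞` so that `u / √0 = ∞` is interpreted correctly. -/
theorem orlicz_KE_lower_bound {N : ℕ} (ψ : ℝ → ℝ)
    (hψ_conv : ConvexOn ℝ (Set.Ici 0) ψ)
    (hψ_mono : MonotoneOn ψ (Set.Ici 0))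
    (hψ_nonneg : ∀ s ∈ Set.Ici (0 : ℝ), 0 ≤ ψ s)
    (hψ_zero : ψ 0 = 0)
    (hψ_top : Filter.Tendsto ψ Filter.atTop Filter.atTop)
    (t : ℝ) (ht : 0 < t)
    (x : Fin N → ℝ)
    (hxE : t ≤ sInf {ρ : ℝ | 0 < ρ ∧ ∑ j, ψ (|x j| / ρ) ≤ 1})
    (hx_inf : ∀ j, |x j| ≤ 1) :
    ⨅ u ∈ Set.Ioc (0 : ℝ) 1,
        ENNReal.ofReal u / ENNReal.ofReal (Real.sqrt (ψ (u / t)))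
      ≤ ENNReal.ofReal (Real.sqrt (∑ j, x j ^ 2)) := by
  have hmod : 1 ≤ ∑ j, ψ (|x j| / t) := by
    by_contra! h
    obtain ⟨ρ, hρ0, hρt, hρ⟩ := hψ_conv.exists_lt_sum_div_le_one ht x h
    have hbdd : BddBelow {ρ : ℝ | 0 < ρ ∧ ∑ j, ψ (|x j| / ρ) ≤ 1} := ⟨0, fun _ h => h.1.le⟩
    linarith [csInf_le hbdd ⟨hρ0, hρ⟩]
  by_contra! hlt
  set R := Real.sqrt (∑ j, x j ^ 2) with hR
  have hR2 : R ^ 2 = ∑ j, x j ^ 2 := Real.sq_sqrt (Finset.sum_nonneg fun j _ => sq_nonneg _)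
  have hpt : ∀ j, x j ≠ 0 → R ^ 2 * ψ (|x j| / t) < x j ^ 2 := by
    intro j hj
    have hu : |x j| ∈ Set.Ioc (0 : ℝ) 1 := ⟨abs_pos.2 hj, hx_inf j⟩
    have h := ENNReal.mul_lt_of_lt_div (hlt.trans_le (iInf₂_le |x j| hu))
    rw [← ENNReal.ofReal_mul (Real.sqrt_nonneg _), ENNReal.ofReal_lt_ofReal_iff hu.1] at h
    have hsq := pow_lt_pow_left₀ h (by positivity) two_ne_zero
    rwa [mul_pow, Real.sq_sqrt (hψ_nonneg _ (Set.mem_Ici.2 (by positivity))), sq_abs] at hsq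
  obtain ⟨i, hi⟩ : ∃ i, x i ≠ 0 := by
    by_contra! h
    norm_num [h, hψ_zero] at hmod
  have hsum : ∑ j, R ^ 2 * ψ (|x j| / t) < ∑ j, x j ^ 2 := by
    refine Finset.sum_lt_sum (fun j _ => ?_) ⟨i, Finset.mem_univ i, hpt i hi⟩
    by_cases hj : x j = 0
    · simp [hj, hψ_zero]
    · exact (hpt j hj).le
  rw [← Finset.mul_sum, ← hR2] at hsum
  nlinarith [sq_nonneg R]
end

section
/- Let q ≥ 2, let V₁, …, V_N be normed vector spaces, let V be their ℓ_q-direct sum, let μ_j be probability measures on V_j each supported on a compact set of diameter at most 1, and let P be the product measure. If F : V → ℝ is 1-Lipschitz and quasiconvex, then for every median M of F, |E F − M| ≤ 4^{1+1/q} Γ(1 + 1/q), where Γ is the Gamma function. -/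
open MeasureTheory

section Concentration

open Set ENNReal NNReal

section Exponential

/-- The real exponential with values in `ℝ≥0∞`. -/
noncomputable def expE (r : ℝ) : ℝ≥0∞ := ENNReal.ofReal (Real.exp r)

lemma expE_add (a b : ℝ) : expE (a + b) = expE a * expE b := by
  rw [expE, Real.exp_add, ENNReal.ofReal_mul (Real.exp_nonneg _), expE, expE]

lemma expE_zero : expE 0 = 1 := by simp [expE]

lemma expE_le_expE {a b : ℝ} : expE a ≤ expE b ↔ a ≤ b := by
  rw [expE, expE, ENNReal.ofReal_le_ofReal_iff (Real.exp_nonneg _), Real.exp_le_exp]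

lemma expE_mono : Monotone expE := fun _ _ h => expE_le_expE.2 h

lemma continuous_expE : Continuous expE :=
  ENNReal.continuous_ofReal.comp Real.continuous_exp

lemma expE_ne_top (a : ℝ) : expE a ≠ ∞ := ENNReal.ofReal_ne_top

lemma expE_rpow (r a : ℝ) : expE r ^ a = expE (a * r) := by
  rw [expE, ENNReal.ofReal_rpow_of_pos (Real.exp_pos _), ← Real.exp_mul, mul_comm, expE]

lemma expE_log {a : ℝ≥0∞} (h0 : a ≠ 0) (ht : a ≠ ∞) : expE (Real.log a.toReal) = a := by
  rw [expE, Real.exp_log (ENNReal.toReal_pos h0 ht), ENNReal.ofReal_toReal ht]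

lemma expE_neg_mul (a : ℝ) : expE (-a) * expE a = 1 := by
  rw [← expE_add, neg_add_cancel, expE_zero]

end Exponential

section Infima

lemma lipschitzWith_iInf {X ι : Type*} [PseudoMetricSpace X] [Nonempty ι] {φ : ι → X → ℝ}
    {K : ℝ≥0} (h : ∀ i, LipschitzWith K (φ i)) (hb : ∀ x, BddBelow (range fun i => φ i x)) :
    LipschitzWith K fun x => ⨅ i, φ i x := by
  refine LipschitzWith.of_le_add_mul K fun x y => ?_
  rw [← sub_le_iff_le_add]
  refine le_ciInf fun i => ?_
  rw [sub_le_iff_le_add]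
  exact (ciInf_le (hb x) i).trans ((h i).le_add_mul x y)

lemma convexOn_iInf {E ι : Type*} [AddCommGroup E] [Module ℝ E] [Nonempty ι] {φ : ι → E → ℝ}
    (hb : ∀ x, BddBelow (range fun i => φ i x))
    (h : ∀ (x y : E) (i j : ι) (a b : ℝ), 0 ≤ a → 0 ≤ b → a + b = 1 →
      ∃ k, φ k (a • x + b • y) ≤ a * φ i x + b * φ j y) :
    ConvexOn ℝ univ fun x => ⨅ i, φ i x := by
  refine ⟨convex_univ, fun x _ y _ a b ha hb' hab => ?_⟩
  refine le_of_forall_pos_le_add fun ε hε => ?_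
  obtain ⟨i, hi⟩ := exists_lt_of_ciInf_lt (lt_add_of_pos_right (⨅ i, φ i x) hε)
  obtain ⟨j, hj⟩ := exists_lt_of_ciInf_lt (lt_add_of_pos_right (⨅ i, φ i y) hε)
  obtain ⟨k, hk⟩ := h x y i j a b ha hb' hab
  refine (ciInf_le (hb _) k).trans (hk.trans ?_)
  have h1 := mul_le_mul_of_nonneg_left hi.le ha
  have h2 := mul_le_mul_of_nonneg_left hj.le hb'
  have h3 : a * ε + b * ε = ε := by rw [← add_mul, hab, one_mul]
  simp only [smul_eq_mul]
  linarith

lemma convexOn_infDist {E : Type*} [SeminormedAddCommGroup E] [NormedSpace ℝ E] {s : Set E}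
    (hs : Convex ℝ s) (hne : s.Nonempty) : ConvexOn ℝ univ fun x => Metric.infDist x s := by
  have : Nonempty s := hne.to_subtype
  simp only [Metric.infDist_eq_iInf]
  refine convexOn_iInf (fun x => ⟨0, by rintro _ ⟨i, rfl⟩; exact dist_nonneg⟩) ?_
  rintro x y ⟨u, hu⟩ ⟨v, hv⟩ a b ha hb hab
  refine ⟨⟨a • u + b • v, hs hu hv ha hb hab⟩, ?_⟩
  simp only [dist_eq_norm]
  calc ‖a • x + b • y - (a • u + b • v)‖ = ‖a • (x - u) + b • (y - v)‖ := by
        congr 1; simp only [smul_sub]; abel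
    _ ≤ _ := (norm_add_le _ _).trans_eq (by
        rw [norm_smul, norm_smul, Real.norm_of_nonneg ha, Real.norm_of_nonneg hb])

end Infima

section ConvexTau

/-- The infimal convolution of `f` with the cost `w`. -/
noncomputable def infConv {V : Type*} [AddCommGroup V] (w f : V → ℝ) (x : V) : ℝ :=
  ⨅ u, f (x - u) + w u

/-- Maurey's convex property `(τ)` of the measure `μ` for the cost `w`, for nonnegative convex
Lipschitz functions. -/
def HasConvexTau {V : Type*} [NormedAddCommGroup V] [NormedSpace ℝ V] [MeasurableSpace V]
    (μ : Measure V) (w : V → ℝ) : Prop :=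
  ∀ f : V → ℝ, ConvexOn ℝ univ f → (∃ K, LipschitzWith K f) → (∀ x, 0 ≤ f x) →
    (∫⁻ x, expE (infConv w f x) ∂μ) * ∫⁻ x, expE (-f x) ∂μ ≤ 1

lemma bddBelow_range_add {ι : Type*} {f g : ι → ℝ} (hf : ∀ x, 0 ≤ f x) (hg : ∀ x, 0 ≤ g x) :
    BddBelow (range fun x => f x + g x) :=
  ⟨0, by rintro _ ⟨x, rfl⟩; exact add_nonneg (hf x) (hg x)⟩

lemma infConv_le {V : Type*} [AddCommGroup V] {w f : V → ℝ} (hw : ∀ x, 0 ≤ w x)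
    (hf : ∀ x, 0 ≤ f x) (x u : V) : infConv w f x ≤ f (x - u) + w u :=
  ciInf_le (bddBelow_range_add (fun u => hf (x - u)) hw) u

lemma infConv_nonneg {V : Type*} [AddCommGroup V] {w f : V → ℝ} (hw : ∀ x, 0 ≤ w x)
    (hf : ∀ x, 0 ≤ f x) (x : V) : 0 ≤ infConv w f x :=
  le_ciInf fun _ => add_nonneg (hf _) (hw _)

lemma lipschitzWith_infConv {V : Type*} [SeminormedAddCommGroup V] {w f : V → ℝ} {K : ℝ≥0}
    (hK : LipschitzWith K f) (hw : ∀ x, 0 ≤ w x) (hf : ∀ x, 0 ≤ f x) :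
    LipschitzWith K (infConv w f) := by
  refine lipschitzWith_iInf (fun u => LipschitzWith.of_le_add_mul K fun z z' => ?_) fun z =>
    bddBelow_range_add (fun _ => hf _) hw
  have := hK.le_add_mul (z - u) (z' - u)
  rw [dist_sub_right] at this
  linarith

lemma lipschitzWith_infConv_fst {V₁ V₂ : Type*} [SeminormedAddCommGroup V₁]
    [SeminormedAddCommGroup V₂] {f : V₁ × V₂ → ℝ} {K : ℝ≥0} (hK : LipschitzWith K f)
    {w : V₁ → ℝ} (hw : ∀ x, 0 ≤ w x) (hf : ∀ x, 0 ≤ f x) :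
    LipschitzWith K fun z : V₁ × V₂ => infConv w (fun x => f (x, z.2)) z.1 := by
  refine lipschitzWith_iInf (fun u => LipschitzWith.of_le_add_mul K fun z z' => ?_) fun z =>
    bddBelow_range_add (fun _ => hf _) hw
  have h := hK.le_add_mul (z.1 - u, z.2) (z'.1 - u, z'.2)
  have h' : dist (z.1 - u, z.2) (z'.1 - u, z'.2) = dist z z' := by
    simp [Prod.dist_eq]
  rw [h'] at h
  linarith

variable {V₁ V₂ : Type*} [NormedAddCommGroup V₁] [NormedSpace ℝ V₁] [NormedAddCommGroup V₂]
  [NormedSpace ℝ V₂]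

lemma ConvexOn.infConv_snd {f : V₁ × V₂ → ℝ} (hc : ConvexOn ℝ univ f) {w : V₁ → ℝ}
    (hwc : ConvexOn ℝ univ w) (hw : ∀ x, 0 ≤ w x) (hf : ∀ x, 0 ≤ f x) (x : V₁) :
    ConvexOn ℝ univ fun y => infConv w (fun x => f (x, y)) x := by
  refine convexOn_iInf (fun z => bddBelow_range_add (fun _ => hf _) hw) ?_
  intro y y' u v a b ha hb hab
  refine ⟨a • u + b • v, ?_⟩
  have h1 := hc.2 (mem_univ (x - u, y)) (mem_univ (x - v, y')) ha hb hab
  have h2 := hwc.2 (mem_univ u) (mem_univ v) ha hb hab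
  have h3 : (x - (a • u + b • v), a • y + b • y') = a • (x - u, y) + b • (x - v, y') := by
    ext
    · simp only [Prod.smul_mk, Prod.mk_add_mk, smul_sub]
      rw [show a • x - a • u + (b • x - b • v) = (a • x + b • x) - (a • u + b • v) by abel,
        ← add_smul, hab, one_smul]
    · simp
  rw [← h3] at h1
  simp only [smul_eq_mul] at h1 h2
  linarith

variable [MeasurableSpace V₁] [BorelSpace V₁] [SecondCountableTopology V₁]
  [MeasurableSpace V₂] [BorelSpace V₂] [SecondCountableTopology V₂]

theorem HasConvexTau.prod {μ₁ : Measure V₁} {μ₂ : Measure V₂} [IsProbabilityMeasure μ₁]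
    [IsProbabilityMeasure μ₂] {w₁ : V₁ → ℝ} {w₂ : V₂ → ℝ} (h₁ : HasConvexTau μ₁ w₁)
    (h₂ : HasConvexTau μ₂ w₂) (hwc : ConvexOn ℝ univ w₁) (hw₁ : ∀ x, 0 ≤ w₁ x)
    (hw₁0 : w₁ 0 = 0) (hw₂ : ∀ x, 0 ≤ w₂ x) (hbdd : ∃ R : ℝ, ∀ᵐ x ∂μ₁, ‖x‖ ≤ R) :
    HasConvexTau (μ₁.prod μ₂) fun z => w₁ z.1 + w₂ z.2 := by
  rintro f hc ⟨K, hK⟩ hf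
  obtain ⟨R, hR⟩ := hbdd
  set h : V₁ × V₂ → ℝ := fun z => infConv w₁ (fun x => f (x, z.2)) z.1 with hh
  have hhK : LipschitzWith K h := lipschitzWith_infConv_fst hK hw₁ hf
  have hh0 : ∀ z, 0 ≤ h z := fun z => infConv_nonneg hw₁ (fun _ => hf _) _
  have hw : ∀ z : V₁ × V₂, 0 ≤ w₁ z.1 + w₂ z.2 := fun z => add_nonneg (hw₁ _) (hw₂ _)
  have hmeas : Measurable fun z => expE (h z) := (continuous_expE.comp hhK.continuous).measurable
  set G : V₂ → ℝ≥0∞ := fun y => ∫⁻ x, expE (h (x, y)) ∂μ₁ with hG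
  have hG1 : ∀ y, 1 ≤ G y := fun y => by
    calc (1 : ℝ≥0∞) = ∫⁻ _, 1 ∂μ₁ := by simp
      _ ≤ G y := lintegral_mono fun x => by
        rw [← expE_zero]; exact expE_mono (hh0 _)
  have hGtop : ∀ y, G y ≠ ∞ := fun y => by
    refine ne_top_of_le_ne_top (expE_ne_top (f (0, y) + K * R)) ?_
    calc G y ≤ ∫⁻ _, expE (f (0, y) + K * R) ∂μ₁ := by
          refine lintegral_mono_ae ?_
          filter_upwards [hR] with x hx
          refine expE_mono ((infConv_le hw₁ (fun _ => hf _) x 0).trans ?_)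
          have h1 := hK.le_add_mul (x, y) (0, y)
          have h2 : dist (x, y) (0, y) = ‖x‖ := by simp [Prod.dist_eq]
          rw [h2] at h1
          simp only [sub_zero, hw₁0, add_zero]
          exact h1.trans (by gcongr)
      _ = _ := by simp
  set g : V₂ → ℝ := fun y => Real.log (G y).toReal with hg
  have hgG : ∀ y, expE (g y) = G y := fun y =>
    expE_log (one_pos.trans_le (hG1 y)).ne' (hGtop y)
  have hg0 : ∀ y, 0 ≤ g y := fun y => by
    rw [← expE_le_expE, expE_zero, hgG]; exact hG1 y
  have hgc : ConvexOn ℝ univ g := by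
    refine ⟨convex_univ, fun y _ y' _ a b ha hb hab => ?_⟩
    rw [← expE_le_expE, hgG, expE_add, smul_eq_mul, smul_eq_mul, ← expE_rpow, ← expE_rpow, hgG,
      hgG]
    refine le_trans ?_ (ENNReal.lintegral_mul_norm_pow_le
      (hmeas.comp (measurable_id.prodMk measurable_const)).aemeasurable
      (hmeas.comp (measurable_id.prodMk measurable_const)).aemeasurable ha hb hab)
    refine lintegral_mono fun x => ?_
    simp only [Function.comp, id, expE_rpow, ← expE_add]
    exact expE_mono ((hc.infConv_snd hwc hw₁ hf x).2 (mem_univ y) (mem_univ y') ha hb hab)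
  have hgK : LipschitzWith K g := by
    refine LipschitzWith.of_le_add_mul K fun y y' => ?_
    rw [← expE_le_expE, expE_add, hgG, hgG, ← lintegral_mul_const' _ _ (expE_ne_top _)]
    refine lintegral_mono fun x => ?_
    rw [← expE_add]
    refine expE_mono ((hhK.le_add_mul (x, y) (x, y')).trans_eq ?_)
    simp [Prod.dist_eq]
  have hQ : ∀ y, ∫⁻ x, expE (infConv (fun z : V₁ × V₂ => w₁ z.1 + w₂ z.2) f (x, y)) ∂μ₁ ≤
      expE (infConv w₂ g y) := fun y => by
    rw [infConv, expE_mono.map_ciInf_of_continuousAt continuous_expE.continuousAt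
      (bddBelow_range_add (fun _ => hg0 _) hw₂)]
    refine le_iInf fun v => ?_
    rw [expE_add, hgG, ← lintegral_mul_const' _ _ (expE_ne_top _)]
    refine lintegral_mono fun x => ?_
    rw [← expE_add]
    refine expE_mono ?_
    rw [← sub_le_iff_le_add]
    refine le_ciInf fun u => ?_
    have := infConv_le hw hf (x, y) (u, v)
    simp only [Prod.mk_sub_mk] at this
    linarith
  have hneg : ∀ y, ∫⁻ x, expE (-f (x, y)) ∂μ₁ ≤ expE (-g y) := fun y => by
    have h1 := h₁ (fun x => f (x, y))
      ⟨convex_univ, fun x _ x' _ a b ha hb hab => by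
        have := hc.2 (mem_univ (x, y)) (mem_univ (x', y)) ha hb hab
        simpa [← add_smul, hab] using this⟩
      ⟨K, LipschitzWith.of_le_add_mul K fun x x' => by
        simpa [Prod.dist_eq] using hK.le_add_mul (x, y) (x', y)⟩ (fun _ => hf _)
    change G y * _ ≤ 1 at h1
    calc ∫⁻ x, expE (-f (x, y)) ∂μ₁ = expE (-g y) * (G y * ∫⁻ x, expE (-f (x, y)) ∂μ₁) := by
          rw [← hgG, ← mul_assoc, expE_neg_mul, one_mul]
      _ ≤ expE (-g y) * 1 := by gcongr
      _ = _ := mul_one _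
  have hQmeas : Measurable fun z =>
      expE (infConv (fun z : V₁ × V₂ => w₁ z.1 + w₂ z.2) f z) :=
    (continuous_expE.comp (lipschitzWith_infConv hK hw hf).continuous).measurable
  have hfmeas : Measurable fun z => expE (-f z) :=
    (continuous_expE.comp hK.continuous.neg).measurable
  rw [lintegral_prod_symm _ hQmeas.aemeasurable, lintegral_prod_symm _ hfmeas.aemeasurable]
  refine le_trans ?_ (h₂ g hgc ⟨K, hgK⟩ hg0)
  gcongr with y y
  · exact hQ y
  · exact hneg y

end ConvexTau
section CompactSupport

lemma exists_exp_add_exp_neg_le_two {t : ℝ} (ht : 0 ≤ t) :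
    ∃ l : ℝ, 0 ≤ l ∧ l ≤ 1 ∧ Real.exp ((1 - l) * t + l ^ 2 / 8) + Real.exp (-t) ≤ 2 := by
  have hexp : ∀ s : ℝ, |s| ≤ 1 → Real.exp s ≤ 1 + s + s ^ 2 := fun s hs => by
    have := (abs_le.1 (Real.abs_exp_sub_one_sub_id_le hs)).2
    linarith
  rcases le_total t (1 / 2) with h | h
  · refine ⟨2 * t, by linarith, by linarith, ?_⟩
    have hs : (1 - 2 * t) * t + (2 * t) ^ 2 / 8 = t - 3 / 2 * t ^ 2 := by ring
    rw [hs]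
    have h0 : 0 ≤ t - 3 / 2 * t ^ 2 := by nlinarith
    have h1 := hexp (t - 3 / 2 * t ^ 2) (by rw [abs_of_nonneg h0]; nlinarith)
    have h2 : (t - 3 / 2 * t ^ 2) ^ 2 ≤ t ^ 2 := by
      apply pow_le_pow_left₀ h0; nlinarith
    have h3 : Real.exp (-t) ≤ 1 - t + t ^ 2 / 2 := by
      have h4 := Real.quadratic_le_exp_of_nonneg ht
      rw [Real.exp_neg]
      refine (inv_anti₀ (by positivity) h4).trans ?_
      rw [inv_le_iff_one_le_mul₀ (by positivity)]
      nlinarith [sq_nonneg (t ^ 2)]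
    linarith
  · refine ⟨1, zero_le_one, le_rfl, ?_⟩
    have h1 := hexp (1 / 8) (by norm_num [abs_le])
    have h2 := hexp (-(1 / 2)) (by norm_num [abs_le])
    have h3 : Real.exp (-t) ≤ Real.exp (-(1 / 2)) := Real.exp_le_exp.2 (by linarith)
    norm_num at h1 h2 ⊢
    linarith

lemma mul_le_one_of_add_le_two {a b : ℝ≥0∞} (h : a + b ≤ 2) : a * b ≤ 1 := by
  have ha : a ≠ ∞ := ne_top_of_le_ne_top (by simp) (le_self_add.trans h)
  have hb : b ≠ ∞ := ne_top_of_le_ne_top (by simp) (le_add_self.trans h)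
  lift a to ℝ≥0 using ha
  lift b to ℝ≥0 using hb
  norm_cast at h ⊢
  have h' : (a : ℝ) + b ≤ 2 := by exact_mod_cast h
  have : (a : ℝ) * b ≤ 1 := by
    nlinarith [sq_nonneg ((a : ℝ) - b), a.coe_nonneg, b.coe_nonneg]
  exact_mod_cast this

theorem hasConvexTau_of_diam_le_one {V : Type*} [NormedAddCommGroup V] [NormedSpace ℝ V]
    [MeasurableSpace V] [BorelSpace V] {μ : Measure V} [IsProbabilityMeasure μ] {s : Set V}
    (hs : IsCompact s) (hd : Metric.diam s ≤ 1) (hμ : ∀ᵐ x ∂μ, x ∈ s) {q : ℝ} (hq : 2 ≤ q) :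
    HasConvexTau μ fun u => ‖u‖ ^ q / 8 := by
  rintro f hc ⟨K, hK⟩ hf
  have hne : s.Nonempty := let ⟨x, hx⟩ := hμ.exists; ⟨x, hx⟩
  obtain ⟨y, hy, hmin⟩ := hs.exists_isMinOn hne hK.continuous.continuousOn
  have hfmeas : Measurable fun x => expE (-f x) :=
    (continuous_expE.comp hK.continuous.neg).measurable
  have hw : ∀ u : V, 0 ≤ ‖u‖ ^ q / 8 := fun u => by positivity
  have key : ∀ x ∈ s,
      expE (-f y) * expE (infConv (fun u => ‖u‖ ^ q / 8) f x) + expE (f y) * expE (-f x) ≤ 2 := by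
    intro x hx
    have ht : 0 ≤ f x - f y := sub_nonneg.2 (hmin hx)
    obtain ⟨l, hl0, hl1, hl⟩ := exists_exp_add_exp_neg_le_two ht
    have hQ := infConv_le hw hf x (l • (x - y))
    have h1 : f (x - l • (x - y)) ≤ (1 - l) * f x + l * f y := by
      have := hc.2 (mem_univ x) (mem_univ y) (sub_nonneg.2 hl1) hl0 (sub_add_cancel 1 l)
      rwa [show (1 - l) • x + l • y = x - l • (x - y) by
        simp only [sub_smul, smul_sub, one_smul]; abel] at this
    have h2 : ‖l • (x - y)‖ ^ q ≤ l ^ 2 := by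
      have hn : ‖x - y‖ ≤ 1 := by
        rw [← dist_eq_norm]; exact (Metric.dist_le_diam_of_mem hs.isBounded hx hy).trans hd
      calc ‖l • (x - y)‖ ^ q ≤ l ^ q := by
            refine Real.rpow_le_rpow (norm_nonneg _) ?_ (by linarith)
            rw [norm_smul, Real.norm_of_nonneg hl0]
            exact mul_le_of_le_one_right hl0 hn
        _ ≤ l ^ (2 : ℝ) := Real.rpow_le_rpow_of_exponent_ge_of_imp hl0 hl1 hq (by intros; linarith)
        _ = l ^ 2 := by norm_cast
    rw [← expE_add, ← expE_add]
    calc _ ≤ expE ((1 - l) * (f x - f y) + l ^ 2 / 8) + expE (-(f x - f y)) := by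
          gcongr
          · refine expE_mono ?_
            linarith
          · exact expE_mono (by linarith)
      _ ≤ 2 := by
          rw [expE, expE, ← ENNReal.ofReal_add (Real.exp_nonneg _) (Real.exp_nonneg _)]
          exact (ENNReal.ofReal_le_ofReal hl).trans_eq (by simp)
  have hsum : expE (-f y) * (∫⁻ x, expE (infConv (fun u => ‖u‖ ^ q / 8) f x) ∂μ) +
      expE (f y) * ∫⁻ x, expE (-f x) ∂μ ≤ 2 := by
    rw [← lintegral_const_mul' _ _ (expE_ne_top _), ← lintegral_const_mul' _ _ (expE_ne_top _),
      ← lintegral_add_right _ (hfmeas.const_mul _)]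
    calc _ ≤ ∫⁻ _, 2 ∂μ := lintegral_mono_ae (hμ.mono key)
      _ = 2 := by simp
  have := mul_le_one_of_add_le_two hsum
  rwa [mul_mul_mul_comm, expE_neg_mul, one_mul] at this

lemma HasConvexTau.of_equiv {W V : Type*} [NormedAddCommGroup W] [NormedSpace ℝ W]
    [MeasurableSpace W] [BorelSpace W] [NormedAddCommGroup V] [NormedSpace ℝ V]
    [MeasurableSpace V] [BorelSpace V] (e : W ≃L[ℝ] V) {ν : Measure W} {μ : Measure V}
    (he : MeasurePreserving e ν μ) {w : V → ℝ} (h : HasConvexTau ν fun x => w (e x)) :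
    HasConvexTau μ w := by
  rintro f hc ⟨K, hK⟩ hf
  have hemb : MeasurableEmbedding e := e.toHomeomorph.measurableEmbedding
  have hfe : ConvexOn ℝ univ fun x => f (e x) := hc.comp_linearMap (e : W →ₗ[ℝ] V)
  have := h _ hfe ⟨_, hK.comp e.lipschitz⟩ fun x => hf _
  rw [← he.lintegral_comp_emb hemb, ← he.lintegral_comp_emb hemb]
  convert this using 5 with x
  refine (e.surjective.iInf_congr _ fun u => ?_).symm
  simp

lemma convexOn_norm_rpow_div {V : Type*} [SeminormedAddCommGroup V] [NormedSpace ℝ V] {q : ℝ}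
    (hq : 1 ≤ q) : ConvexOn ℝ univ fun u : V => ‖u‖ ^ q / 8 := by
  refine ⟨convex_univ, fun x _ y _ a b ha hb hab => ?_⟩
  have h1 : ‖a • x + b • y‖ ≤ a * ‖x‖ + b * ‖y‖ := (norm_add_le _ _).trans_eq (by
    rw [norm_smul, norm_smul, Real.norm_of_nonneg ha, Real.norm_of_nonneg hb])
  have h2 := (convexOn_rpow hq).2 (norm_nonneg x) (norm_nonneg y) ha hb hab
  have h3 := (Real.rpow_le_rpow (norm_nonneg _) h1 (by linarith : 0 ≤ q)).trans h2
  simp only [smul_eq_mul] at h3 ⊢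
  linarith

lemma measurePreserving_finConsEquivL {N : ℕ} {V : Fin (N + 1) → Type*}
    [∀ j, NormedAddCommGroup (V j)] [∀ j, NormedSpace ℝ (V j)] [∀ j, MeasurableSpace (V j)]
    [∀ j, BorelSpace (V j)] [∀ j, SecondCountableTopology (V j)]
    (μ : ∀ j, Measure (V j)) [∀ j, IsProbabilityMeasure (μ j)] :
    MeasurePreserving (Fin.consEquivL ℝ V) ((μ 0).prod (Measure.pi fun j => μ j.succ))
      (Measure.pi μ) := by
  have hm : Measurable (Fin.consEquivL ℝ V) := (Fin.consEquivL ℝ V).continuous.measurable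
  refine ⟨hm, (Measure.pi_eq fun s hs => ?_).symm⟩
  rw [Measure.map_apply hm (MeasurableSet.univ_pi hs), Fin.prod_univ_succ, ← Measure.pi_pi,
    ← Measure.prod_prod]
  congr 1
  ext ⟨x, y⟩
  simp [Fin.forall_fin_succ, Fin.consEquivL, Fin.consLinearEquiv, Fin.consEquiv]

theorem hasConvexTau_pi {q : ℝ} (hq : 2 ≤ q) : ∀ {N : ℕ} (V : Fin N → Type*)
    [∀ j, NormedAddCommGroup (V j)] [∀ j, NormedSpace ℝ (V j)] [∀ j, MeasurableSpace (V j)]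
    [∀ j, BorelSpace (V j)] [∀ j, SecondCountableTopology (V j)]
    (μ : ∀ j, Measure (V j)) [∀ j, IsProbabilityMeasure (μ j)],
    (∀ j, ∃ s : Set (V j), IsCompact s ∧ Metric.diam s ≤ 1 ∧ ∀ᵐ x ∂μ j, x ∈ s) →
    HasConvexTau (Measure.pi μ) fun u => ∑ j, ‖u j‖ ^ q / 8
  | 0, V, _, _, _, _, _, μ, _, _ => by
    have := hasConvexTau_of_diam_le_one (μ := Measure.pi μ) (s := univ)
      subsingleton_univ.finite.isCompact
      ((Metric.diam_subsingleton subsingleton_univ).trans_le zero_le_one) (by simp) hq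
    convert this using 2 with u
    have hq0 : q ≠ 0 := by linarith
    simp [Subsingleton.elim u 0, Real.zero_rpow hq0]
  | N + 1, V, _, _, _, _, _, μ, _, hs => by
    have hq0 : q ≠ 0 := by linarith
    refine HasConvexTau.of_equiv (Fin.consEquivL ℝ V) (measurePreserving_finConsEquivL μ) ?_
    obtain ⟨s, hsc, hsd, hsμ⟩ := hs 0
    obtain ⟨R, hR⟩ := hsc.isBounded.exists_norm_le
    have h := (hasConvexTau_of_diam_le_one hsc hsd hsμ hq).prod
      (hasConvexTau_pi hq (fun j => V j.succ) (fun j => μ j.succ) fun j => hs j.succ)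
      (convexOn_norm_rpow_div (by linarith)) (fun x => by positivity)
      (by simp [Real.zero_rpow hq0]) (fun x => by positivity) ⟨R, hsμ.mono hR⟩
    convert h using 2 with z
    simp [Fin.sum_univ_succ, Fin.consEquivL, Fin.consLinearEquiv, Fin.consEquiv]

end CompactSupport
section Deviation

lemma lipschitzWith_const_mul {X : Type*} [PseudoMetricSpace X] {f : X → ℝ} {K : ℝ≥0}
    (hf : LipschitzWith K f) {c : ℝ} (hc : 0 ≤ c) :
    LipschitzWith (c.toNNReal * K) fun x => c * f x := by
  refine LipschitzWith.of_le_add_mul _ fun x y => ?_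
  have := mul_le_mul_of_nonneg_left (hf.le_add_mul x y) hc
  simp only [NNReal.coe_mul, Real.coe_toNNReal _ hc]
  linarith

/-- The tangent line inequality for `r ↦ r ^ q` at `t`. -/
lemma rpow_add_mul_sub_le_rpow {q t r : ℝ} (hq : 1 ≤ q) (ht : 0 < t) (hr : 0 ≤ r) :
    t ^ q + q * (t ^ q / t) * (r - t) ≤ r ^ q := by
  have h0 : 0 ≤ r / t := by positivity
  have h := one_add_mul_self_le_rpow_one_add (by linarith : -1 ≤ r / t - 1) hq
  rw [add_sub_cancel, Real.div_rpow hr ht.le, le_div_iff₀ (by positivity)] at h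
  calc _ = (1 + q * (r / t - 1)) * t ^ q := by field_simp
    _ ≤ _ := h

variable {N : ℕ} {V : Fin N → Type*} [∀ j, NormedAddCommGroup (V j)]
  [∀ j, NormedSpace ℝ (V j)]

lemma convex_image_toLp {p : ℝ≥0∞} {A : Set (∀ j, V j)} (hA : Convex ℝ A) :
    Convex ℝ (WithLp.toLp p '' A) :=
  hA.linear_image (WithLp.linearEquiv p ℝ (∀ j, V j)).symm.toLinearMap

variable [∀ j, MeasurableSpace (V j)] [∀ j, BorelSpace (V j)]
  [∀ j, SecondCountableTopology (V j)]
  (μ : ∀ j, Measure (V j)) [∀ j, IsProbabilityMeasure (μ j)]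

/-- Talagrand's convex distance inequality in the `ℓ_q`-sum of normed spaces. -/
theorem measure_infDist_ge_mul_le_one {q : ℝ} (hq : 2 ≤ q) [Fact (1 ≤ ENNReal.ofReal q)]
    (hs : ∀ j, ∃ s : Set (V j), IsCompact s ∧ Metric.diam s ≤ 1 ∧ ∀ᵐ x ∂μ j, x ∈ s)
    {A : Set (∀ j, V j)} (hA : Convex ℝ A) (hne : A.Nonempty) {t : ℝ} (ht : 0 < t) :
    expE (t ^ q / 8) * Measure.pi μ {x | t ≤ Metric.infDist (WithLp.toLp (ENNReal.ofReal q) x)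
      (WithLp.toLp (ENNReal.ofReal q) '' A)} * Measure.pi μ A ≤ 1 := by
  set p := ENNReal.ofReal q with hp
  have hpq : p.toReal = q := ENNReal.toReal_ofReal (by linarith)
  set D : (∀ j, V j) → ℝ := fun x => Metric.infDist (WithLp.toLp p x) (WithLp.toLp p '' A)
    with hD
  set L : ℝ := q * (t ^ q / t) / 8 with hL
  have hL0 : 0 ≤ L := by positivity
  set w : (∀ j, V j) → ℝ := fun u => ∑ j, ‖u j‖ ^ q / 8 with hw
  have hw0 : ∀ u, 0 ≤ w u := fun u => by positivity
  have hDc : ConvexOn ℝ univ D :=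
    (convexOn_infDist (convex_image_toLp hA) (hne.image _)).comp_linearMap
      (WithLp.linearEquiv p ℝ (∀ j, V j)).symm.toLinearMap
  have hDK := (Metric.lipschitz_infDist_pt (WithLp.toLp p '' A)).comp
    (PiLp.lipschitzWith_toLp p V)
  have hfK := lipschitzWith_const_mul hDK hL0
  have hf0 : ∀ x, 0 ≤ L * D x := fun x => mul_nonneg hL0 Metric.infDist_nonneg
  have hτ := hasConvexTau_pi hq V μ hs (fun x => L * D x) (hDc.smul hL0) ⟨_, hfK⟩ hf0
  have hQ : ∀ x, t ≤ D x → t ^ q / 8 ≤ infConv w (fun x => L * D x) x := by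
    intro x hx
    refine le_ciInf fun u => ?_
    set r := ‖WithLp.toLp p u‖ with hr
    have hrq : r ^ q / 8 = w u := by
      have hq0 : q ≠ 0 := by linarith
      rw [hr, PiLp.norm_eq_sum (by rw [hpq]; linarith), hpq, one_div,
        Real.rpow_inv_rpow (by positivity) hq0, Finset.sum_div]
    have h1 : D x ≤ D (x - u) + r := by
      have := Metric.infDist_le_infDist_add_dist (s := WithLp.toLp p '' A)
        (x := WithLp.toLp p x) (y := WithLp.toLp p (x - u))
      rwa [dist_eq_norm, ← WithLp.toLp_sub, show x - (x - u) = u from sub_sub_cancel x u] at this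
    have h2 := rpow_add_mul_sub_le_rpow (by linarith : 1 ≤ q) ht (norm_nonneg (WithLp.toLp p u))
    have h3 : L * (t - r) ≤ L * D (x - u) := mul_le_mul_of_nonneg_left (by linarith) hL0
    rw [← hr] at h2
    rw [← hrq]
    have h4 : q * (t ^ q / t) * (r - t) = -(8 * (L * (t - r))) := by rw [hL]; ring
    linarith
  refine le_trans ?_ hτ
  gcongr
  · refine le_trans ?_ (mul_meas_ge_le_lintegral
      (continuous_expE.comp (lipschitzWith_infConv hfK hw0 hf0).continuous).measurable
      (expE (t ^ q / 8)))
    gcongr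
    exact fun h => expE_mono (hQ _ h)
  · rw [← one_mul (Measure.pi μ A)]
    refine le_trans ?_ (mul_meas_ge_le_lintegral
      (continuous_expE.comp hfK.continuous.neg).measurable 1)
    gcongr
    intro x hx
    have : D x = 0 := Metric.infDist_zero_of_mem (mem_image_of_mem _ hx)
    change 1 ≤ expE (-(L * D x))
    simp [this, expE_zero]

/-- A quasiconvex function which is `1`-Lipschitz for the `ℓ_q`-norm cannot be far from both of two
levels with large probability. -/
theorem measure_ge_mul_measure_le {q : ℝ} (hq : 2 ≤ q)
    (hs : ∀ j, ∃ s : Set (V j), IsCompact s ∧ Metric.diam s ≤ 1 ∧ ∀ᵐ x ∂μ j, x ∈ s)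
    {F : (∀ j, V j) → ℝ}
    (hLip : ∀ x y : ∀ j, V j, |F x - F y| ≤ (∑ j, ‖x j - y j‖ ^ q) ^ (1 / q))
    (hqc : ∀ a : ℝ, Convex ℝ {x : ∀ j, V j | F x ≤ a}) {a t : ℝ} (ht : 0 < t) :
    Measure.pi μ {x | a + t ≤ F x} * Measure.pi μ {x | F x ≤ a} ≤ expE (-(t ^ q / 8)) := by
  rcases eq_empty_or_nonempty {x | F x ≤ a} with he | hne
  · simp [he]
  have : Fact (1 ≤ ENNReal.ofReal q) := ⟨by
    rw [← ENNReal.ofReal_one]; exact ENNReal.ofReal_le_ofReal (by linarith)⟩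
  have hpq : (ENNReal.ofReal q).toReal = q := ENNReal.toReal_ofReal (by linarith)
  have h := measure_infDist_ge_mul_le_one μ hq hs (hqc a) hne ht
  set E := {x : ∀ j, V j | t ≤ Metric.infDist (WithLp.toLp (ENNReal.ofReal q) x)
      (WithLp.toLp (ENNReal.ofReal q) '' {x | F x ≤ a})}
  have hE : {x | a + t ≤ F x} ⊆ E := by
    intro x (hx : a + t ≤ F x)
    refine (Metric.le_infDist (hne.image _)).2 ?_
    rintro _ ⟨y, hy : F y ≤ a, rfl⟩
    have h1 := (le_abs_self _).trans (hLip x y)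
    rw [dist_eq_norm, PiLp.norm_eq_sum (by rw [hpq]; linarith), hpq]
    exact le_trans (by linarith) h1
  calc _ ≤ Measure.pi μ E * Measure.pi μ {x | F x ≤ a} := by gcongr
    _ = expE (-(t ^ q / 8)) * (expE (t ^ q / 8) * Measure.pi μ E * Measure.pi μ {x | F x ≤ a}) := by
      rw [← mul_assoc, ← mul_assoc, expE_neg_mul, one_mul]
    _ ≤ expE (-(t ^ q / 8)) * 1 := by gcongr
    _ = _ := mul_one _

end Deviation

section Mean

lemma integral_le_of_measure_ge_le {Ω : Type*} [MeasurableSpace Ω] {μ : Measure Ω} {Y : Ω → ℝ}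
    (hY : Integrable Y μ) {q : ℝ} (hq : 2 ≤ q)
    (h : ∀ t, 0 < t → μ {x | t ≤ Y x} ≤ 2 * expE (-(t ^ q / 8))) :
    ∫ x, Y x ∂μ ≤ 4 ^ (1 + 1 / q) * Real.Gamma (1 + 1 / q) := by
  have hq0 : 0 < q := by linarith
  have hI := integral_exp_neg_mul_rpow hq0 (by norm_num : (0 : ℝ) < 1 / 8)
  have hΓ : 0 < Real.Gamma (1 / q + 1) := Real.Gamma_pos_of_pos (by positivity)
  have hpos : 0 < ((1 / 8 : ℝ) ^ (-1 / q) * Real.Gamma (1 / q + 1)) := by positivity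
  have hint : IntegrableOn (fun x : ℝ => Real.exp (-(1 / 8) * x ^ q)) (Ioi 0) :=
    not_imp_comm.1 integral_undef (by rw [hI]; exact hpos.ne')
  have hlin : ∫⁻ x, ENNReal.ofReal (max (Y x) 0) ∂μ ≤
      ENNReal.ofReal (2 * ((1 / 8 : ℝ) ^ (-1 / q) * Real.Gamma (1 / q + 1))) := by
    rw [lintegral_eq_lintegral_meas_le (f := fun x => max (Y x) 0) μ
      (.of_forall fun x => le_max_right _ _)
      (hY.aemeasurable.max aemeasurable_const), ENNReal.ofReal_mul zero_le_two, ← hI,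
      ofReal_integral_eq_lintegral_ofReal hint (.of_forall fun x => Real.exp_nonneg _),
      ← lintegral_const_mul' _ _ ENNReal.ofReal_ne_top]
    refine setLIntegral_mono_ae' measurableSet_Ioi (.of_forall fun t (ht : 0 < t) => ?_)
    have hset : {x | t ≤ max (Y x) 0} = {x | t ≤ Y x} := by
      ext x; simp [ht.not_ge]
    rw [hset]
    refine (h t ht).trans_eq ?_
    rw [expE, ENNReal.ofReal_ofNat]
    congr 4
    ring
  have hle : ∫ x, Y x ∂μ ≤ 2 * ((1 / 8 : ℝ) ^ (-1 / q) * Real.Gamma (1 / q + 1)) := by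
    calc ∫ x, Y x ∂μ ≤ ∫ x, max (Y x) 0 ∂μ :=
          integral_mono hY hY.pos_part fun x => le_max_left _ _
      _ ≤ _ := by
        rw [← ENNReal.ofReal_le_ofReal_iff (by positivity),
          ofReal_integral_eq_lintegral_ofReal hY.pos_part
            (.of_forall fun x => le_max_right _ _)]
        exact hlin
  refine hle.trans ?_
  rw [← mul_assoc, add_comm (1 / q) 1]
  refine mul_le_mul_of_nonneg_right ?_ (by rw [add_comm]; exact hΓ.le)
  have h8 : (1 / 8 : ℝ) ^ (-1 / q) = 2 ^ (1 / q) * 4 ^ (1 / q) := by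
    rw [← Real.mul_rpow (by norm_num) (by norm_num), neg_div, one_div (8 : ℝ),
      Real.inv_rpow (by norm_num), Real.rpow_neg (by norm_num), inv_inv]
    norm_num
  have h2 : (2 : ℝ) ^ (1 / q) ≤ 2 := by
    calc (2 : ℝ) ^ (1 / q) ≤ 2 ^ (1 : ℝ) :=
          Real.rpow_le_rpow_of_exponent_le one_le_two
            ((div_le_one hq0).2 (by linarith))
      _ = 2 := Real.rpow_one 2
  have h4 : (0 : ℝ) < 4 ^ (1 / q) := by positivity
  rw [h8, Real.rpow_add (by norm_num), Real.rpow_one]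
  nlinarith

lemma le_two_mul_of_mul_le {a b c : ℝ≥0∞} (h : a * b ≤ c) (hb : 1 / 2 ≤ b) : a ≤ 2 * c := by
  calc a = 2 * (a * (1 / 2)) := by
        rw [mul_left_comm, one_div, ENNReal.mul_inv_cancel two_ne_zero ofNat_ne_top, mul_one]
    _ ≤ 2 * c := by gcongr; exact (by gcongr : a * (1 / 2) ≤ a * b).trans h

/-- `mean_median_close` for separable normed spaces. -/
theorem mean_median_close_of_secondCountable {N : ℕ} {q : ℝ} (hq : 2 ≤ q)
    {V : Fin N → Type*} [∀ j, NormedAddCommGroup (V j)] [∀ j, NormedSpace ℝ (V j)]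
    [∀ j, MeasurableSpace (V j)] [∀ j, BorelSpace (V j)] [∀ j, SecondCountableTopology (V j)]
    (μ : ∀ j, Measure (V j)) [∀ j, IsProbabilityMeasure (μ j)]
    (hs : ∀ j, ∃ s : Set (V j), IsCompact s ∧ Metric.diam s ≤ 1 ∧ ∀ᵐ x ∂μ j, x ∈ s)
    {F : (∀ j, V j) → ℝ}
    (hLip : ∀ x y : ∀ j, V j, |F x - F y| ≤ (∑ j, ‖x j - y j‖ ^ q) ^ (1 / q))
    (hqc : ∀ a : ℝ, Convex ℝ {x : ∀ j, V j | F x ≤ a})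
    {M : ℝ} (hM : IsMedian (Measure.pi μ) F M) :
    |(∫ x, F x ∂Measure.pi μ) - M| ≤ 4 ^ (1 + 1 / q) * Real.Gamma (1 + 1 / q) := by
  have hdev := fun a t (ht : 0 < t) => measure_ge_mul_measure_le μ hq hs hLip hqc (a := a) ht
  have : Fact (1 ≤ ENNReal.ofReal q) := ⟨by
    rw [← ENNReal.ofReal_one]; exact ENNReal.ofReal_le_ofReal (by linarith)⟩
  have hpq : (ENNReal.ofReal q).toReal = q := ENNReal.toReal_ofReal (by linarith)
  have hFcont : Continuous F := by
    have h1 : LipschitzWith 1 fun x : PiLp (ENNReal.ofReal q) V => F x.ofLp := by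
      refine LipschitzWith.of_dist_le_mul fun x y => ?_
      rw [dist_eq_norm x y, PiLp.norm_eq_sum (by rw [hpq]; linarith), hpq, NNReal.coe_one, one_mul]
      exact hLip _ _
    exact h1.continuous.comp (PiLp.continuous_toLp (ENNReal.ofReal q) V)
  have hFint : Integrable F (Measure.pi μ) := by
    choose s hsc _ hsμ using hs
    obtain ⟨C, hC⟩ := (isCompact_univ_pi hsc).exists_bound_of_continuousOn hFcont.continuousOn
    refine Integrable.of_bound hFcont.measurable.aestronglyMeasurable C ?_
    have : ∀ᵐ x ∂Measure.pi μ, ∀ j, x j ∈ s j :=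
      ae_all_iff.2 fun j => (Measure.quasiMeasurePreserving_eval μ j).ae (hsμ j)
    filter_upwards [this] with x hx
    exact hC x fun j _ => hx j
  have hsub : (∫ x, F x ∂Measure.pi μ) - M = ∫ x, F x - M ∂Measure.pi μ := by
    rw [integral_sub hFint (integrable_const M)]; simp
  have hsub' : -((∫ x, F x ∂Measure.pi μ) - M) = ∫ x, M - F x ∂Measure.pi μ := by
    rw [integral_sub (integrable_const M) hFint]; simp
  refine abs_le'.2 ⟨?_, ?_⟩
  · rw [hsub]
    refine integral_le_of_measure_ge_le (hFint.sub (integrable_const M)) hq fun t ht => ?_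
    refine le_two_mul_of_mul_le ?_ hM.1
    simpa only [Pi.sub_apply, le_sub_iff_add_le'] using hdev M t ht
  · rw [hsub']
    refine integral_le_of_measure_ge_le ((integrable_const M).sub hFint) hq fun t ht => ?_
    refine le_two_mul_of_mul_le ?_ hM.2
    have := hdev (M - t) t ht
    rw [sub_add_cancel, mul_comm] at this
    simpa only [Pi.sub_apply, le_sub_comm (b := M)] using this

end Mean
section Separable

lemma MeasurableEmbedding.pi_map {ι : Type*} [Countable ι] {α β : ι → Type*}
    [∀ i, MeasurableSpace (α i)] [∀ i, MeasurableSpace (β i)] [∀ i, Nonempty (α i)]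
    {f : ∀ i, α i → β i} (hf : ∀ i, MeasurableEmbedding (f i)) :
    MeasurableEmbedding fun (x : ∀ i, α i) i => f i (x i) := by
  choose g hgm hg using fun i =>
    (hf i).exists_measurable_extend measurable_id fun _ => inferInstance
  refine .of_measurable_inverse (g := fun y i => g i (y i)) ?_ ?_ ?_ fun x => ?_
  · exact measurable_pi_lambda _ fun i => (hf i).measurable.comp (measurable_pi_apply i)
  · rw [show range (fun (x : ∀ i, α i) i => f i (x i)) = univ.pi fun i => range (f i) from
      range_piMap f]
    exact MeasurableSet.univ_pi fun i => (hf i).measurableSet_range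
  · exact measurable_pi_lambda _ fun i => (hgm i).comp (measurable_pi_apply i)
  · exact funext fun i => congrFun (hg i) (x i)

/-- The closed linear span of a compact set. -/
def closedSpan {V : Type*} [NormedAddCommGroup V] [NormedSpace ℝ V] (s : Set V) : Submodule ℝ V :=
  (Submodule.span ℝ s).topologicalClosure

variable {V : Type*} [NormedAddCommGroup V] [NormedSpace ℝ V] {s : Set V}

lemma subset_closedSpan : s ⊆ closedSpan s :=
  Submodule.subset_span.trans (Submodule.le_topologicalClosure _)

lemma secondCountableTopology_closedSpan (hs : IsCompact s) :
    SecondCountableTopology (closedSpan s) :=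
  hs.isSeparable.span.closure.secondCountableTopology

lemma measurableEmbedding_closedSpan [MeasurableSpace V] [BorelSpace V] :
    MeasurableEmbedding (Subtype.val : closedSpan s → V) :=
  .subtype_coe (Submodule.isClosed_topologicalClosure _).measurableSet

end Separable

end Concentration

/-- For a quasiconvex function `F` which is `1`-Lipschitz with respect
to the `ℓ_q`-sum norm (`q ≥ 2`) on a product of normed spaces, under a product of
probability measures supported on compact sets of diameter at most `1`, the mean and
any median of `F` differ by at most `4^{1+1/q} Γ(1 + 1/q)`. -/
theorem mean_median_close {N : ℕ} (q : ℝ) (hq : 2 ≤ q)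
    (V : Fin N → Type*) [∀ j, NormedAddCommGroup (V j)] [∀ j, NormedSpace ℝ (V j)]
    [∀ j, MeasurableSpace (V j)] [∀ j, BorelSpace (V j)]
    (μ : ∀ j, Measure (V j)) [∀ j, IsProbabilityMeasure (μ j)]
    (hsupp : ∀ j, ∃ s : Set (V j), IsCompact s ∧ Metric.diam s ≤ 1 ∧ μ j s = 1)
    (F : (∀ j, V j) → ℝ)
    (hLip : ∀ x y : ∀ j, V j, |F x - F y| ≤ (∑ j, ‖x j - y j‖ ^ q) ^ (1 / q))
    (hqc : ∀ a : ℝ, Convex ℝ {x : ∀ j, V j | F x ≤ a})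
    (M : ℝ) (hM : IsMedian (Measure.pi μ) F M) :
    |(∫ x, F x ∂Measure.pi μ) - M| ≤ 4 ^ (1 + 1 / q) * Real.Gamma (1 + 1 / q) := by
  choose s hsc hsd hsμ using hsupp
  have hsae : ∀ j, ∀ᵐ x ∂μ j, x ∈ s j := fun j =>
    (prob_compl_eq_zero_iff (hsc j).measurableSet).2 (hsμ j)
  have := fun j => secondCountableTopology_closedSpan (hsc j)
  let ν : ∀ j, Measure (closedSpan (s j)) := fun j => (μ j).comap Subtype.val
  have hmap : ∀ j, (ν j).map Subtype.val = μ j := fun j => by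
    rw [measurableEmbedding_closedSpan.map_comap, Subtype.range_coe]
    exact Measure.restrict_eq_self_of_ae_mem ((hsae j).mono fun x hx => subset_closedSpan hx)
  have hν : ∀ j, IsProbabilityMeasure (ν j) := fun j => by
    have : IsProbabilityMeasure ((ν j).map Subtype.val) := by rw [hmap]; infer_instance
    exact Measure.isProbabilityMeasure_of_map (Subtype.val : closedSpan (s j) → V j)
  let e : (∀ j, closedSpan (s j)) → ∀ j, V j := fun x j => x j
  have he : MeasurableEmbedding e :=
    .pi_map fun j => measurableEmbedding_closedSpan
  have hpi : (Measure.pi ν).map e = Measure.pi μ := by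
    have : ∀ j, SigmaFinite ((ν j).map Subtype.val) := fun j => by rw [hmap]; infer_instance
    have h := Measure.pi_map_pi (μ := ν) (f := fun j => (Subtype.val : closedSpan (s j) → V j))
      fun j => measurable_subtype_coe.aemeasurable
    simpa only [hmap] using h
  rw [IsMedian, ← hpi, he.map_apply, he.map_apply] at hM
  rw [← hpi, he.integral_map]
  refine mean_median_close_of_secondCountable hq ν (fun j => ?_) (F := fun x => F (e x))
    (fun x y => hLip (e x) (e y)) (fun a => ?_) hM
  · have himg : Subtype.val '' (Subtype.val ⁻¹' s j : Set (closedSpan (s j))) = s j := by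
      refine Set.image_preimage_eq_of_subset ?_
      rw [Subtype.range_coe]
      exact subset_closedSpan
    refine ⟨Subtype.val ⁻¹' s j, ?_, ?_, ?_⟩
    · rw [Subtype.isCompact_iff, himg]
      exact hsc j
    · exact (isometry_subtype_coe.diam_image _).symm.trans_le
        ((congrArg Metric.diam himg).trans_le (hsd j))
    · have h := hsae j
      rwa [← hmap j, measurableEmbedding_closedSpan.ae_map_iff] at h
  · exact (hqc a).linear_preimage (LinearMap.pi fun j => (closedSpan (s j)).subtype ∘ₗ
      LinearMap.proj j)
end
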